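/- For all sufficiently large n, H(Res(f₀+f₁x+f₂x²+f₃x³, g₀+g₁x+⋯+gₙxⁿ)) = H(Res(f₀+f₁x+f₂x²+f₃x³, g₀+gₙxⁿ)); that is, the height of the resultant of a generic cubic with a generic degree-n polynomial equals the height of the resultant of a generic cubic with the generic binomial g₀ + gₙxⁿ. -/

import Mathlib

noncomputable section

open MvPolynomial

/-- The generic Sylvester matrix of a degree-`m` polynomial `f = f₀ + ⋯ + f_m xᵐ` and a
degree-`n` polynomial `g = g₀ + ⋯ + gₙ xⁿ`: its first `n` columns contain the shifted
coefficients of `f` (the indeterminates `Sum.inl i`) and its last `m` columns contain the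
shifted coefficients of `g` (the indeterminates `Sum.inr j`). -/
def sylvesterMatrix (m n : ℕ) :
    Matrix (Fin (m + n)) (Fin (m + n)) (MvPolynomial (Fin (m + 1) ⊕ Fin (n + 1)) ℤ) :=
  Matrix.of fun i j =>
    if (j : ℕ) < n then
      if h : (j : ℕ) ≤ (i : ℕ) ∧ (i : ℕ) - (j : ℕ) ≤ m then
        X (Sum.inl ⟨(i : ℕ) - (j : ℕ), Nat.lt_succ_of_le h.2⟩)
      else 0
    else
      if h : (j : ℕ) - n ≤ (i : ℕ) ∧ (i : ℕ) - ((j : ℕ) - n) ≤ n then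
        X (Sum.inr ⟨(i : ℕ) - ((j : ℕ) - n), Nat.lt_succ_of_le h.2⟩)
      else 0

/-- `genRes m n` is the Sylvester resultant `Res(f,g)` of the generic polynomials
`f` of degree `m` and `g` of degree `n`. -/
def genRes (m n : ℕ) : MvPolynomial (Fin (m + 1) ⊕ Fin (n + 1)) ℤ :=
  (sylvesterMatrix m n).det

/-- The height of an integer multivariate polynomial:
the maximum of the absolute values of its coefficients. -/
def height {σ : Type*} (P : MvPolynomial σ ℤ) : ℕ :=
  P.support.sup fun s => (P.coeff s).natAbs

/-- The algebra map specializing the generic degree-`n` polynomial `g` to the generic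
binomial `g₀ + gₙ xⁿ`, i.e. setting `g₁ = ⋯ = g_{n-1} = 0`. -/
def toBinomial (m n : ℕ) :
    MvPolynomial (Fin (m + 1) ⊕ Fin (n + 1)) ℤ →ₐ[ℤ] MvPolynomial (Fin (m + 1) ⊕ Fin (n + 1)) ℤ :=
  aeval fun s => match s with
    | Sum.inl i => X (Sum.inl i)
    | Sum.inr j => if (j : ℕ) = 0 ∨ (j : ℕ) = n then X (Sum.inr j) else 0

/-- All coefficients of `p` are bounded by `r` in absolute value. -/
def CoeffBound {σ : Type*} (p : MvPolynomial σ ℤ) (r : ℝ) : Prop :=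
  ∀ s, |((coeff s p : ℤ) : ℝ)| ≤ r

/-- All coefficients of `p` are nonnegative. -/
def CoeffNonneg {σ : Type*} (p : MvPolynomial σ ℤ) : Prop :=
  ∀ s, 0 ≤ coeff s p

/-- Multiplication by `q` increases bounds on coefficients by a factor at most `k`. -/
def MulBound {σ : Type*} (q : MvPolynomial σ ℤ) (k : ℝ) : Prop :=
  ∀ p r, CoeffBound p r → CoeffBound (q * p) (k * r)

section Bounds

variable {σ : Type*} {p q : MvPolynomial σ ℤ} {r r' k l : ℝ}

lemma CoeffBound.nonneg (h : CoeffBound p r) : 0 ≤ r := (abs_nonneg _).trans (h 0)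

lemma CoeffBound.mono (h : CoeffBound p r) (hr : r ≤ r') : CoeffBound p r' :=
  fun s => (h s).trans hr

lemma CoeffBound.add (hp : CoeffBound p r) (hq : CoeffBound q r') :
    CoeffBound (p + q) (r + r') := fun s => by
  rw [coeff_add, Int.cast_add]
  exact (abs_add_le _ _).trans (add_le_add (hp s) (hq s))

lemma CoeffBound.neg (hp : CoeffBound p r) : CoeffBound (-p) r := fun s => by
  simpa using hp s

lemma CoeffBound.sub (hp : CoeffBound p r) (hq : CoeffBound q r') :
    CoeffBound (p - q) (r + r') := by
  rw [sub_eq_add_neg]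
  exact hp.add hq.neg

lemma CoeffBound.sub_of_nonneg (hp : CoeffBound p r) (hq : CoeffBound q r)
    (hp' : CoeffNonneg p) (hq' : CoeffNonneg q) : CoeffBound (p - q) r := fun s => by
  have h₁ := (abs_le.1 (hp s)).2
  have h₂ := (abs_le.1 (hq s)).2
  have h₃ : (0 : ℝ) ≤ ((coeff s p : ℤ) : ℝ) := by exact_mod_cast hp' s
  have h₄ : (0 : ℝ) ≤ ((coeff s q : ℤ) : ℝ) := by exact_mod_cast hq' s
  rw [coeff_sub, Int.cast_sub, abs_le]
  constructor <;> linarith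

lemma coeffBound_one : CoeffBound (1 : MvPolynomial σ ℤ) 1 := fun s => by
  classical
  rw [coeff_one]
  split_ifs <;> simp

lemma coeffBound_height (p : MvPolynomial σ ℤ) : CoeffBound p (height p) := fun s => by
  by_cases h : s ∈ p.support
  · have := Finset.le_sup (f := fun s => (p.coeff s).natAbs) h
    rw [← Int.cast_abs, Int.abs_eq_natAbs]
    exact_mod_cast this
  · rw [notMem_support_iff.1 h]
    simp

lemma CoeffBound.height_le (h : CoeffBound p r) : (height p : ℝ) ≤ r := by
  rcases p.support.eq_empty_or_nonempty with he | hne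
  · simpa [height, he] using h.nonneg
  · obtain ⟨s, -, hs⟩ := Finset.exists_mem_eq_sup _ hne fun s => (p.coeff s).natAbs
    have := h s
    rw [← Int.cast_abs, Int.abs_eq_natAbs, Int.cast_natCast] at this
    rwa [height, hs]

lemma mulBound_X (i : σ) : MulBound (X i) 1 := fun p r h s => by
  classical
  rw [coeff_X_mul', one_mul]
  split_ifs
  · exact h _
  · simpa using h.nonneg

lemma mulBound_natCast (n : ℕ) : MulBound (n : MvPolynomial σ ℤ) n := fun p r h s => by
  have : (n : MvPolynomial σ ℤ) = C (n : ℤ) := by simp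
  rw [this, coeff_C_mul, Int.cast_mul, abs_mul]
  simpa using mul_le_mul_of_nonneg_left (h s) n.cast_nonneg

lemma MulBound.mul (hp : MulBound p k) (hq : MulBound q l) : MulBound (p * q) (k * l) :=
  fun a r h => by
    rw [mul_assoc, mul_assoc]
    exact hp _ _ (hq _ _ h)

lemma MulBound.pow (hp : MulBound p k) (n : ℕ) : MulBound (p ^ n) (k ^ n) := by
  induction n with
  | zero => simpa using mulBound_natCast (σ := σ) 1
  | succ n ih => simpa only [pow_succ] using ih.mul hp

lemma MulBound.add (hp : MulBound p k) (hq : MulBound q l) : MulBound (p + q) (k + l) :=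
  fun a r h => by
    rw [add_mul, add_mul]
    exact (hp _ _ h).add (hq _ _ h)

lemma MulBound.neg (hp : MulBound p k) : MulBound (-p) k := fun a r h => by
  rw [neg_mul]
  exact (hp _ _ h).neg

lemma MulBound.sub (hp : MulBound p k) (hq : MulBound q l) : MulBound (p - q) (k + l) := by
  rw [sub_eq_add_neg]
  exact hp.add hq.neg

lemma CoeffNonneg.add (hp : CoeffNonneg p) (hq : CoeffNonneg q) : CoeffNonneg (p + q) :=
  fun s => by simpa using add_nonneg (hp s) (hq s)

lemma CoeffNonneg.mul (hp : CoeffNonneg p) (hq : CoeffNonneg q) : CoeffNonneg (p * q) :=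
  fun s => by
    classical
    rw [coeff_mul]
    exact Finset.sum_nonneg fun x _ => mul_nonneg (hp _) (hq _)

lemma coeffNonneg_X (i : σ) : CoeffNonneg (X i : MvPolynomial σ ℤ) := fun s => by
  classical
  rw [coeff_X]
  split_ifs <;> simp

lemma coeffNonneg_natCast (n : ℕ) : CoeffNonneg (n : MvPolynomial σ ℤ) := fun s => by
  classical
  have : (n : MvPolynomial σ ℤ) = C (n : ℤ) := by simp
  rw [this, coeff_C]
  split_ifs <;> simp

lemma CoeffNonneg.pow (hp : CoeffNonneg p) (n : ℕ) : CoeffNonneg (p ^ n) := by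
  induction n with
  | zero => simpa using coeffNonneg_natCast (σ := σ) 1
  | succ n ih => simpa only [pow_succ] using ih.mul hp

end Bounds

/-- The power sum `h₀ⁿ (αⁿ + βⁿ + γⁿ)` of the roots of `h₀ x³ - h₁ x² - h₂ x - h₃`, as a
polynomial in the coefficients. -/
def powerSum : ℕ → MvPolynomial (Fin 4) ℤ
  | 0 => 3
  | 1 => X 1
  | 2 => X 1 * X 1 + 2 * (X 2 * X 0)
  | n + 3 => X 1 * powerSum (n + 2) + X 2 * X 0 * powerSum (n + 1)
      + X 3 * X 0 * X 0 * powerSum n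

/-- The linear recurrent sequence with the same recurrence as `powerSum` and initial
values `0, 0, 1`; its entries are generating polynomials of trinomial coefficients. -/
def impulseResponse : ℕ → MvPolynomial (Fin 4) ℤ
  | 0 => 0
  | 1 => 0
  | 2 => 1
  | n + 3 => X 1 * impulseResponse (n + 2) + X 2 * X 0 * impulseResponse (n + 1)
      + X 3 * X 0 * X 0 * impulseResponse n

lemma powerSum_succ (n : ℕ) :
    powerSum (n + 1) = X 1 * impulseResponse (n + 2) + 2 * (X 2 * X 0 * impulseResponse (n + 1))
      + 3 * (X 3 * X 0 * X 0 * impulseResponse n) := by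
  induction n using Nat.strong_induction_on with
  | _ n ih =>
    match n with
    | 0 => simp [powerSum, impulseResponse]
    | 1 => simp [powerSum, impulseResponse]
    | 2 => simp [powerSum, impulseResponse]; ring
    | n + 3 =>
      rw [powerSum, ih (n + 2) (by lia), ih (n + 1) (by lia), ih n (by lia)]
      simp only [impulseResponse]
      ring

/-- The coefficient of `p` at `s`, multiplied by `s₁! s₂! s₃!`. -/
def weightedCoeff (p : MvPolynomial (Fin 4) ℤ) (s : Fin 4 →₀ ℕ) : ℤ :=
  coeff s p * ((s 1).factorial * (s 2).factorial * (s 3).factorial)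

lemma weightedCoeff_add (p q : MvPolynomial (Fin 4) ℤ) (s : Fin 4 →₀ ℕ) :
    weightedCoeff (p + q) s = weightedCoeff p s + weightedCoeff q s := by
  simp [weightedCoeff, add_mul]

lemma weightedCoeff_natCast_mul (n : ℕ) (p : MvPolynomial (Fin 4) ℤ) (s : Fin 4 →₀ ℕ) :
    weightedCoeff (n * p) s = n * weightedCoeff p s := by
  have : (n : MvPolynomial (Fin 4) ℤ) = C (n : ℤ) := by simp
  rw [weightedCoeff, this, coeff_C_mul, weightedCoeff, mul_assoc]

lemma weightedCoeff_X_zero_mul (p : MvPolynomial (Fin 4) ℤ) (s : Fin 4 →₀ ℕ) :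
    weightedCoeff (X 0 * p) s =
      if s 0 = 0 then 0 else weightedCoeff p (s - Finsupp.single 0 1) := by
  by_cases h : s 0 = 0 <;> simp [weightedCoeff, coeff_X_mul', h]

lemma weightedCoeff_X_mul {i : Fin 4} (hi : i ≠ 0) (p : MvPolynomial (Fin 4) ℤ)
    (s : Fin 4 →₀ ℕ) :
    weightedCoeff (X i * p) s = s i * weightedCoeff p (s - Finsupp.single i 1) := by
  by_cases h : s i = 0
  · simp [weightedCoeff, coeff_X_mul', h]
  · obtain ⟨m, hm⟩ := Nat.exists_eq_succ_of_ne_zero h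
    fin_cases i <;> simp_all [weightedCoeff, coeff_X_mul', Nat.factorial_succ] <;> ring

lemma weightedCoeff_impulseResponse (n : ℕ) (s : Fin 4 →₀ ℕ) :
    weightedCoeff (impulseResponse n) s =
      if s 1 + 2 * s 2 + 3 * s 3 + 2 = n ∧ s 0 = s 2 + 2 * s 3 then
        ((s 1 + s 2 + s 3).factorial : ℤ) else 0 := by
  induction n using Nat.strong_induction_on generalizing s with
  | _ n ih =>
    match n with
    | 0 => simp [impulseResponse, weightedCoeff]
    | 1 => simp [impulseResponse, weightedCoeff]
    | 2 =>
      rw [impulseResponse, weightedCoeff, coeff_one]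
      by_cases h : 0 = s
      · subst h; simp
      · rw [if_neg h, if_neg, zero_mul]
        rintro ⟨h₁, h₂⟩
        apply h
        ext i
        fin_cases i <;> simp <;> lia
    | n + 3 =>
      rw [impulseResponse]
      simp only [weightedCoeff_add, mul_assoc, weightedCoeff_X_zero_mul,
        weightedCoeff_X_mul (show (1 : Fin 4) ≠ 0 by decide),
        weightedCoeff_X_mul (show (2 : Fin 4) ≠ 0 by decide),
        weightedCoeff_X_mul (show (3 : Fin 4) ≠ 0 by decide),
        ih (n + 2) (by lia), ih (n + 1) (by lia), ih n (by lia)]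
      simp only [Finsupp.coe_tsub, Pi.sub_apply, Finsupp.single_apply, Fin.reduceEq, if_true,
        if_false, tsub_zero]
      generalize s 0 = d, s 1 = a, s 2 = b, s 3 = c
      by_cases h : a + 2 * b + 3 * c + 2 = n + 3 ∧ d = b + 2 * c
      · obtain ⟨h, rfl⟩ := h
        obtain ⟨m, hm⟩ : ∃ m, a + b + c = m + 1 := ⟨a + b + c - 1, by lia⟩
        have h₁ : (a : ℤ) * (if a - 1 + 2 * b + 3 * c + 2 = n + 2 ∧ b + 2 * c = b + 2 * c then
            ((a - 1 + b + c).factorial : ℤ) else 0) = a * m.factorial := by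
          rcases Nat.eq_zero_or_pos a with rfl | ha
          · simp
          · rw [if_pos (by lia), show a - 1 + b + c = m by lia]
        have h₂ : (b : ℤ) * (if b + 2 * c = 0 then 0 else if a + 2 * (b - 1) + 3 * c + 2 = n + 1 ∧
            b + 2 * c - 1 = b - 1 + 2 * c then ((a + (b - 1) + c).factorial : ℤ) else 0) =
            b * m.factorial := by
          rcases Nat.eq_zero_or_pos b with rfl | hb
          · simp
          · rw [if_neg (by lia), if_pos (by lia), show a + (b - 1) + c = m by lia]
        have h₃ : (c : ℤ) * (if b + 2 * c = 0 then 0 else if b + 2 * c - 1 = 0 then 0 else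
            if a + 2 * b + 3 * (c - 1) + 2 = n ∧ b + 2 * c - 1 - 1 = b + 2 * (c - 1) then
              ((a + b + (c - 1)).factorial : ℤ) else 0) = c * m.factorial := by
          rcases Nat.eq_zero_or_pos c with rfl | hc
          · simp
          · rw [if_neg (by lia), if_neg (by lia), if_pos (by lia),
              show a + b + (c - 1) = m by lia]
        rw [h₁, h₂, h₃, if_pos ⟨h, rfl⟩, hm, Nat.factorial_succ, ← hm]
        push_cast
        ring
      · rw [if_neg h]
        have h₁ : (a : ℤ) * (if a - 1 + 2 * b + 3 * c + 2 = n + 2 ∧ d = b + 2 * c then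
            ((a - 1 + b + c).factorial : ℤ) else 0) = 0 := by
          rcases Nat.eq_zero_or_pos a with rfl | ha
          · simp
          · rw [if_neg (by lia), mul_zero]
        have h₂ : (b : ℤ) * (if d = 0 then 0 else if a + 2 * (b - 1) + 3 * c + 2 = n + 1 ∧
            d - 1 = b - 1 + 2 * c then ((a + (b - 1) + c).factorial : ℤ) else 0) = 0 := by
          rcases Nat.eq_zero_or_pos b with rfl | hb
          · simp
          · rw [ite_eq_left_iff.2 fun _ => if_neg (by lia), mul_zero]
        have h₃ : (c : ℤ) * (if d = 0 then 0 else if d - 1 = 0 then 0 else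
            if a + 2 * b + 3 * (c - 1) + 2 = n ∧ d - 1 - 1 = b + 2 * (c - 1) then
              ((a + b + (c - 1)).factorial : ℤ) else 0) = 0 := by
          rcases Nat.eq_zero_or_pos c with rfl | hc
          · simp
          · rw [ite_eq_left_iff.2 fun _ => ite_eq_left_iff.2 fun _ => if_neg (by lia), mul_zero]
        rw [h₁, h₂, h₃]
        rfl

lemma weightedCoeff_powerSum (n : ℕ) (s : Fin 4 →₀ ℕ) :
    weightedCoeff (powerSum (n + 1)) s =
      if s 1 + 2 * s 2 + 3 * s 3 = n + 1 ∧ s 0 = s 2 + 2 * s 3 then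
        ((n + 1) * (s 1 + s 2 + s 3 - 1).factorial : ℤ) else 0 := by
  have h2 : (2 : MvPolynomial (Fin 4) ℤ) = (2 : ℕ) := by norm_cast
  have h3 : (3 : MvPolynomial (Fin 4) ℤ) = (3 : ℕ) := by norm_cast
  rw [powerSum_succ, h2, h3]
  simp only [weightedCoeff_add, mul_assoc, weightedCoeff_X_zero_mul, weightedCoeff_natCast_mul,
    weightedCoeff_X_mul (show (1 : Fin 4) ≠ 0 by decide),
    weightedCoeff_X_mul (show (2 : Fin 4) ≠ 0 by decide),
    weightedCoeff_X_mul (show (3 : Fin 4) ≠ 0 by decide), weightedCoeff_impulseResponse]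
  simp only [Finsupp.coe_tsub, Pi.sub_apply, Finsupp.single_apply, Fin.reduceEq, if_true,
    if_false, tsub_zero]
  generalize s 0 = d, s 1 = a, s 2 = b, s 3 = c
  by_cases h : a + 2 * b + 3 * c = n + 1 ∧ d = b + 2 * c
  · obtain ⟨h, rfl⟩ := h
    set m := a + b + c - 1 with hm
    have h₁ : (a : ℤ) * (if a - 1 + 2 * b + 3 * c + 2 = n + 2 ∧ b + 2 * c = b + 2 * c then
        ((a - 1 + b + c).factorial : ℤ) else 0) = a * m.factorial := by
      rcases Nat.eq_zero_or_pos a with rfl | ha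
      · simp
      · rw [if_pos (by lia), show a - 1 + b + c = m by lia]
    have h₂ : (b : ℤ) * (if b + 2 * c = 0 then 0 else if a + 2 * (b - 1) + 3 * c + 2 = n + 1 ∧
        b + 2 * c - 1 = b - 1 + 2 * c then ((a + (b - 1) + c).factorial : ℤ) else 0) =
        b * m.factorial := by
      rcases Nat.eq_zero_or_pos b with rfl | hb
      · simp
      · rw [if_neg (by lia), if_pos (by lia), show a + (b - 1) + c = m by lia]
    have h₃ : (c : ℤ) * (if b + 2 * c = 0 then 0 else if b + 2 * c - 1 = 0 then 0 else
        if a + 2 * b + 3 * (c - 1) + 2 = n ∧ b + 2 * c - 1 - 1 = b + 2 * (c - 1) then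
          ((a + b + (c - 1)).factorial : ℤ) else 0) = c * m.factorial := by
      rcases Nat.eq_zero_or_pos c with rfl | hc
      · simp
      · rw [if_neg (by lia), if_neg (by lia), if_pos (by lia),
          show a + b + (c - 1) = m by lia]
    rw [h₁, h₂, h₃, if_pos ⟨h, rfl⟩]
    have : ((n : ℤ) + 1) = a + 2 * b + 3 * c := by exact_mod_cast h.symm
    rw [this]
    push_cast
    ring
  · rw [if_neg h]
    have h₁ : (a : ℤ) * (if a - 1 + 2 * b + 3 * c + 2 = n + 2 ∧ d = b + 2 * c then
        ((a - 1 + b + c).factorial : ℤ) else 0) = 0 := by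
      rcases Nat.eq_zero_or_pos a with rfl | ha
      · simp
      · rw [if_neg (by lia), mul_zero]
    have h₂ : (b : ℤ) * (if d = 0 then 0 else if a + 2 * (b - 1) + 3 * c + 2 = n + 1 ∧
        d - 1 = b - 1 + 2 * c then ((a + (b - 1) + c).factorial : ℤ) else 0) = 0 := by
      rcases Nat.eq_zero_or_pos b with rfl | hb
      · simp
      · rw [ite_eq_left_iff.2 fun _ => if_neg (by lia), mul_zero]
    have h₃ : (c : ℤ) * (if d = 0 then 0 else if d - 1 = 0 then 0 else
        if a + 2 * b + 3 * (c - 1) + 2 = n ∧ d - 1 - 1 = b + 2 * (c - 1) then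
          ((a + b + (c - 1)).factorial : ℤ) else 0) = 0 := by
      rcases Nat.eq_zero_or_pos c with rfl | hc
      · simp
      · rw [ite_eq_left_iff.2 fun _ => ite_eq_left_iff.2 fun _ => if_neg (by lia), mul_zero]
    rw [h₁, h₂, h₃]
    simp

lemma factorial_le_height_powerSum {n i j k : ℕ} (h : i + 2 * j + 3 * k = n + 1) :
    ((n : ℝ) + 1) * (i + j + k - 1).factorial ≤
      height (powerSum (n + 1)) * (i.factorial * j.factorial * k.factorial) := by
  have := weightedCoeff_powerSum n (Finsupp.equivFunOnFinite.symm ![j + 2 * k, i, j, k])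
  simp only [weightedCoeff, Finsupp.equivFunOnFinite_symm_apply_apply, Matrix.cons_val] at this
  rw [if_pos ⟨h, trivial⟩] at this
  have h' : ((n : ℝ) + 1) * (i + j + k - 1).factorial =
    ((coeff (Finsupp.equivFunOnFinite.symm ![j + 2 * k, i, j, k]) (powerSum (n + 1)) : ℤ) : ℝ) *
      (i.factorial * j.factorial * k.factorial) := by exact_mod_cast this.symm
  rw [h']
  gcongr
  exact (le_abs_self _).trans (coeffBound_height _ _)

lemma height_powerSum_pos (n : ℕ) : 0 < height (powerSum (n + 1)) := by
  by_contra! h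
  have := factorial_le_height_powerSum (n := n) (i := n + 1) (j := 0) (k := 0) (by lia)
  rw [Nat.le_zero.1 h] at this
  simp at this
  have h' : (0 : ℝ) < ((n : ℝ) + 1) * n.factorial := by positivity
  linarith

lemma exists_height_powerSum_eq (n : ℕ) : ∃ i j k, i + 2 * j + 3 * k = n + 1 ∧
    (height (powerSum (n + 1)) : ℝ) * (i.factorial * j.factorial * k.factorial) =
      ((n : ℝ) + 1) * (i + j + k - 1).factorial := by
  have hne : (powerSum (n + 1)).support.Nonempty := by
    by_contra h
    have := height_powerSum_pos n
    simp [height, Finset.not_nonempty_iff_eq_empty.1 h] at this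
  obtain ⟨s, -, hs⟩ := Finset.exists_mem_eq_sup _ hne
    fun s => ((powerSum (n + 1)).coeff s).natAbs
  have hpos := height_powerSum_pos n
  rw [height, hs] at hpos
  have hw := weightedCoeff_powerSum n s
  split_ifs at hw with hc
  · refine ⟨s 1, s 2, s 3, hc.1, ?_⟩
    rw [weightedCoeff] at hw
    have h0 : 0 ≤ coeff s (powerSum (n + 1)) := by
      by_contra! h
      have : 0 < (((s 1).factorial * (s 2).factorial * (s 3).factorial : ℕ) : ℤ) := by positivity
      have h' : (0 : ℤ) ≤ ((n : ℤ) + 1) * (s 1 + s 2 + s 3 - 1).factorial := by positivity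
      push_cast at this
      nlinarith
    have h1 : (height (powerSum (n + 1)) : ℤ) = coeff s (powerSum (n + 1)) := by
      rw [height, hs, Int.natAbs_of_nonneg h0]
    rw [← h1] at hw
    exact_mod_cast hw
  · have : 0 < (((s 1).factorial * (s 2).factorial * (s 3).factorial : ℕ) : ℤ) := by positivity
    push_cast at this
    rw [weightedCoeff, mul_eq_zero] at hw
    rcases hw with hw | hw
    · simp [hw] at hpos
    · exact absurd hw this.ne'

lemma cubic_lt_of_lt {x K : ℝ} (hx : 100000 ≤ x) (hxK : x ≤ K) (hK : K < 1.838 * (x + 1)) :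
    K ^ 2 * (K + 2 - x) < x * (x - 1) * K + x * (x - 1) * (x - 2) := by
  have h1 : K ^ 2 * (K + 2 - x) - x * (x - 1) * K ≤
      (1.838 * (x + 1)) ^ 2 * (1.838 * (x + 1) + 2 - x) - x * (x - 1) * (1.838 * (x + 1)) := by
    set L := 1.838 * (x + 1)
    have : (L ^ 2 * (L + 2 - x) - x * (x - 1) * L) - (K ^ 2 * (K + 2 - x) - x * (x - 1) * K)
      = (L - K) * (L * (L - x) + K * (K - x) + (L * K - x * x) + x + 2 * (L + K)) := by ring
    have hL : 0 ≤ L - K := by linarith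
    have : 0 ≤ (L - K) * (L * (L - x) + K * (K - x) + (L * K - x * x) + x + 2 * (L + K)) := by
      apply mul_nonneg hL
      have a1 : 0 ≤ L * (L - x) := mul_nonneg (by linarith) (by linarith)
      have a2 : 0 ≤ K * (K - x) := mul_nonneg (by linarith) (by linarith)
      have a3 : x * x ≤ L * K := mul_le_mul (by linarith) (by linarith) (by linarith) (by linarith)
      linarith
    linarith
  refine lt_of_sub_pos ?_
  obtain ⟨d, hd, rfl⟩ : ∃ d : ℝ, 0 ≤ d ∧ x = 100000 + d := ⟨x - 100000, by linarith, by ring⟩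
  have h2 : 0 < (100000 + d) * (100000 + d - 1) * (100000 + d - 2)
      - ((1.838 * (100000 + d + 1)) ^ 2 * (1.838 * (100000 + d + 1) + 2 - (100000 + d))
        - (100000 + d) * (100000 + d - 1) * (1.838 * (100000 + d + 1))) := by
    ring_nf
    positivity
  linarith

lemma height_powerSum_succ (n : ℕ) (hn : 1000000 ≤ n) :
    1.838 * (height (powerSum (n + 1)) : ℝ) ≤ height (powerSum (n + 2)) := by
  obtain ⟨i, j, k, hijk, hH⟩ := exists_height_powerSum_eq n
  have hpos : (0 : ℝ) < height (powerSum (n + 1)) := by exact_mod_cast height_powerSum_pos n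
  set H : ℝ := (height (powerSum (n + 1)) : ℝ) with hHdef
  have hfi : (0 : ℝ) < i.factorial := by positivity
  have hfj : (0 : ℝ) < j.factorial := by positivity
  have hfk : (0 : ℝ) < k.factorial := by positivity
  rcases le_or_gt (1.838 * ((i : ℝ) + 1)) (i + j + k : ℝ) with hle | hlt
  · have hup := factorial_le_height_powerSum (n := n + 1) (i := i + 1) (j := j) (k := k) (by lia)
    obtain ⟨m, hm⟩ : ∃ m, i + j + k = m + 1 := ⟨i + j + k - 1, by lia⟩
    have hm' : (i + j + k : ℝ) = m + 1 := by exact_mod_cast hm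
    rw [show i + 1 + j + k - 1 = m + 1 by lia] at hup
    rw [show i + j + k - 1 = m by lia] at hH
    rw [hm'] at hle
    simp only [Nat.factorial_succ] at hup
    push_cast at hup
    have h1 : ((i : ℝ) + 1) * (1.838 * H) ≤ (i + 1) * height (powerSum (n + 2)) := by
      have hF : (0 : ℝ) < i.factorial * j.factorial * k.factorial := by positivity
      have h2 : (m + 1) * H * (i.factorial * j.factorial * k.factorial) ≤
          (i + 1) * height (powerSum (n + 2)) * (i.factorial * j.factorial * k.factorial : ℝ) := by
        have h3 : (0 : ℝ) ≤ (m + 1) * m.factorial := by positivity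
        calc (m + 1) * H * (i.factorial * j.factorial * k.factorial)
            = (n + 1) * ((m + 1) * m.factorial) := by rw [mul_assoc, hH]; ring
          _ ≤ (n + 1 + 1) * ((m + 1) * m.factorial) := by gcongr; linarith
          _ ≤ _ := hup
          _ = _ := by ring
      have h4 := le_of_mul_le_mul_right h2 hF
      nlinarith
    exact le_of_mul_le_mul_left h1 (by positivity)
  · exfalso
    have hnR : (1000000 : ℝ) ≤ n := by exact_mod_cast hn
    have hw : (i + 2 * j + 3 * k : ℝ) = n + 1 := by exact_mod_cast hijk
    have hj0 : (0 : ℝ) ≤ j := by positivity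
    have hk0 : (0 : ℝ) ≤ k := by positivity
    have hi0 : (100000 : ℝ) ≤ i := by linarith
    obtain ⟨p, rfl⟩ : ∃ p, i = p + 3 := ⟨i - 3, by
      have : 100000 ≤ i := by exact_mod_cast hi0
      lia⟩
    have hA := factorial_le_height_powerSum (n := n) (i := p + 1) (j := j + 1) (k := k) (by lia)
    have hB := factorial_le_height_powerSum (n := n) (i := p) (j := j) (k := k + 1) (by lia)
    rw [show p + 1 + (j + 1) + k - 1 = p + j + k + 1 by lia] at hA
    rw [show p + j + (k + 1) - 1 = p + j + k by lia] at hB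
    rw [show p + 3 + j + k - 1 = p + j + k + 2 by lia] at hH
    rw [← hHdef] at hA hB
    simp only [Nat.factorial_succ] at hA hB hH
    push_cast at hA hB hH hi0 hlt hw
    have hcub := cubic_lt_of_lt (x := (p : ℝ) + 3) (K := p + 3 + j + k) hi0 (by linarith) hlt
    have hp0 : (0 : ℝ) ≤ p := by positivity
    have hfp : (0 : ℝ) < p.factorial := by positivity
    have hF : (0 : ℝ) < p.factorial * j.factorial * k.factorial := by positivity
    have hG : (0 : ℝ) < (n + 1) * (p + j + k).factorial := by positivity
    set F : ℝ := p.factorial * j.factorial * k.factorial with hFdef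
    set G : ℝ := (n + 1) * (p + j + k).factorial with hGdef
    have hA' : (p + j + k + 1) * G ≤ H * F * ((p + 1) * (j + 1)) := by
      calc _ = _ := by rw [hGdef]; ring
        _ ≤ _ := hA
        _ = _ := by rw [hFdef]; ring
    have hB' : G ≤ H * F * (k + 1) := by
      calc _ = _ := by rw [hGdef]
        _ ≤ _ := hB
        _ = _ := by rw [hFdef]; ring
    have hH' : H * F * ((p + 3) * (p + 2) * (p + 1)) =
        (p + j + k + 2) * (p + j + k + 1) * G := by
      calc _ = _ := by rw [hFdef]; ring
        _ = _ := hH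
        _ = _ := by rw [hGdef]; ring
    have hHF : 0 < H * F := by positivity
    set E := H * F
    set M : ℝ := p + j + k with hM
    have hA2 : (p + 3) * (p + 2) ≤ (M + 2) * ((j : ℝ) + 1) := by
      have : E * (p + 1) * ((p + 3) * (p + 2)) ≤ E * (p + 1) * ((M + 2) * ((j : ℝ) + 1)) := by
        have := mul_le_mul_of_nonneg_left hA' (show 0 ≤ M + 2 by positivity)
        linarith
      exact le_of_mul_le_mul_left this (by positivity)
    have hB2 : (p + 3) * (p + 2) * (p + 1) ≤ (M + 2) * (M + 1) * ((k : ℝ) + 1) := by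
      have : E * ((p + 3) * (p + 2) * (p + 1)) ≤ E * ((M + 2) * (M + 1) * ((k : ℝ) + 1)) := by
        have := mul_le_mul_of_nonneg_left hB' (show 0 ≤ (M + 2) * (M + 1) by positivity)
        linarith
      exact le_of_mul_le_mul_left this hHF
    have hM0 : 0 ≤ M := by positivity
    have hA3 : (p + 3) * (p + 2) * (M + 3) ≤ (M + 3) ^ 2 * ((j : ℝ) + 1) := by
      have h1 := mul_le_mul_of_nonneg_right hA2 (show 0 ≤ M + 3 by positivity)
      have h2 : 0 ≤ (M + 3) * (j + 1) := by positivity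
      linarith
    have hB3 : (p + 3) * (p + 2) * (p + 1) ≤ (M + 3) ^ 2 * ((k : ℝ) + 1) := by
      have h2 : 0 ≤ (3 * M + 7) * ((k : ℝ) + 1) := by positivity
      linarith
    have hK : (p + 3 + j + k : ℝ) = M + 3 := by rw [hM]; ring
    rw [hK] at hcub
    have hj' : (j : ℝ) + k + 2 = M + 3 + 2 - (p + 3) := by rw [hM]; ring
    have : (M + 3) ^ 2 * ((j : ℝ) + 1) + (M + 3) ^ 2 * ((k : ℝ) + 1)
      = (M + 3) ^ 2 * (M + 3 + 2 - (p + 3)) := by rw [← hj']; ring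
    linarith

/-- Specialization of the four variables to the (signed) coefficients of the cubic with leading
coefficient `h` and roots `α`, `β`, `γ`. -/
def rootEval {K : Type*} [CommRing K] (h α β γ : K) : MvPolynomial (Fin 4) ℤ →ₐ[ℤ] K :=
  aeval ![h, h * (α + β + γ), -(h * (α * β + α * γ + β * γ)), h * (α * β * γ)]

section RootEval

variable {K : Type*} [CommRing K] (h α β γ : K)

@[simp] lemma rootEval_X_zero : rootEval h α β γ (X 0) = h := by simp [rootEval]

@[simp] lemma rootEval_X_one : rootEval h α β γ (X 1) = h * (α + β + γ) := by simp [rootEval]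

@[simp] lemma rootEval_X_two :
    rootEval h α β γ (X 2) = -(h * (α * β + α * γ + β * γ)) := by simp [rootEval]

@[simp] lemma rootEval_X_three : rootEval h α β γ (X 3) = h * (α * β * γ) := by simp [rootEval]

@[simp] lemma rootEval_two : rootEval h α β γ 2 = 2 := map_ofNat _ 2

@[simp] lemma rootEval_three : rootEval h α β γ 3 = 3 := map_ofNat _ 3

@[simp] lemma rootEval_four : rootEval h α β γ 4 = 4 := map_ofNat _ 4

lemma rootEval_powerSum (n : ℕ) :
    rootEval h α β γ (powerSum n) = h ^ n * (α ^ n + β ^ n + γ ^ n) := by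
  induction n using Nat.strong_induction_on with
  | _ n ih =>
    match n with
    | 0 => simp [powerSum]; norm_num
    | 1 => simp [powerSum]
    | 2 => simp [powerSum]; ring
    | n + 3 =>
      rw [powerSum]
      simp only [map_add, map_mul, ih (n + 2) (by lia), ih (n + 1) (by lia), ih n (by lia),
        rootEval_X_zero, rootEval_X_one, rootEval_X_two, rootEval_X_three]
      ring

end RootEval

/-- Any four elements of a domain, the first and the last of which are nonzero, are the signed
coefficients of a split cubic with nonzero roots over an extension field. -/
lemma exists_roots {D : Type} [CommRing D] [IsDomain D] {a b c d : D} (ha : a ≠ 0) (hd : d ≠ 0) :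
    ∃ (K : Type) (_ : Field K) (φ : D →+* K) (α β γ : K), Function.Injective φ ∧ α ≠ 0 ∧ β ≠ 0 ∧
      γ ≠ 0 ∧ φ b = φ a * (α + β + γ) ∧ φ c = -(φ a * (α * β + α * γ + β * γ)) ∧
      φ d = φ a * (α * β * γ) := by
  let F := FractionRing D
  let ι : D →+* F := algebraMap D F
  have hι : Function.Injective ι := IsFractionRing.injective D F
  let P : Cubic F := ⟨ι a, -ι b, -ι c, -ι d⟩
  have hP : P.a ≠ 0 := (map_ne_zero_iff ι hι).2 ha
  let ψ : F →+* AlgebraicClosure F := algebraMap F (AlgebraicClosure F)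
  obtain ⟨α, β, γ, h3⟩ := (Cubic.splits_iff_roots_eq_three (φ := ψ) hP).1
    (IsAlgClosed.splits _)
  have hb : ψ (-ι b) = ψ (ι a) * -(α + β + γ) := Cubic.b_eq_three_roots hP h3
  have hc : ψ (-ι c) = ψ (ι a) * (α * β + α * γ + β * γ) := Cubic.c_eq_three_roots hP h3
  have hd' : ψ (-ι d) = ψ (ι a) * -(α * β * γ) := Cubic.d_eq_three_roots hP h3
  rw [map_neg] at hb hc hd'
  have hd0 : ψ (ι d) ≠ 0 := (map_ne_zero_iff ψ ψ.injective).2 ((map_ne_zero_iff ι hι).2 hd)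
  have hne : ψ (ι d) = ψ (ι a) * (α * β * γ) := by linear_combination -hd'
  refine ⟨AlgebraicClosure F, inferInstance, ψ.comp ι, α, β, γ, ψ.injective.comp hι, ?_, ?_, ?_,
    ?_, ?_, hne⟩
  · rintro rfl; simp [hne] at hd0
  · rintro rfl; simp [hne] at hd0
  · rintro rfl; simp [hne] at hd0
  · simp only [RingHom.comp_apply]; linear_combination -hb
  · simp only [RingHom.comp_apply]; linear_combination -hc

lemma eq_of_rootEval_eq {p q : MvPolynomial (Fin 4) ℤ}
    (H : ∀ (K : Type) (_ : Field K) (h α β γ : K), rootEval h α β γ p = rootEval h α β γ q) :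
    p = q := by
  obtain ⟨K, _, φ, α, β, γ, hφ, -, -, -, h1, h2, h3⟩ :=
    exists_roots (D := MvPolynomial (Fin 4) ℤ) (a := X 0) (b := X 1) (c := X 2) (d := X 3)
      (X_ne_zero _) (X_ne_zero _)
  have key : ∀ r, rootEval (φ (X 0)) α β γ r = φ r := by
    intro r
    have : ((rootEval (φ (X 0)) α β γ : MvPolynomial (Fin 4) ℤ →ₐ[ℤ] K) :
        MvPolynomial (Fin 4) ℤ →+* K) = φ := by
      apply MvPolynomial.ringHom_ext
      · intro n
        simp
      · intro i
        fin_cases i <;> simp [h1, h2, h3]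
    exact congrArg (fun f : MvPolynomial (Fin 4) ℤ →+* K => f r) this
  apply hφ
  rw [← key p, ← key q]
  exact H K _ _ _ _ _

/-- The sum of `h₀²ᵇ⁺ᶜ α²ᵇ⁺ᶜ βᵇ` over all ordered pairs of distinct roots `α`, `β`. -/
def mixedSum : ℕ → ℕ → MvPolynomial (Fin 4) ℤ
  | 0, c => 2 * powerSum c
  | 1, c => -(X 2 * powerSum (c + 1) + X 3 * X 0 * powerSum c)
  | b + 2, c => -(X 2 * mixedSum (b + 1) (c + 1) + X 3 * X 0 * mixedSum (b + 1) c)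
      - X 3 * mixedSum b (c + 3)

lemma rootEval_mixedSum {K : Type*} [CommRing K] (h α β γ : K) (b c : ℕ) :
    rootEval h α β γ (mixedSum b c) = h ^ (2 * b + c) *
      (α ^ (2 * b + c) * (β ^ b + γ ^ b) + β ^ (2 * b + c) * (α ^ b + γ ^ b)
        + γ ^ (2 * b + c) * (α ^ b + β ^ b)) := by
  induction b using Nat.strong_induction_on generalizing c with
  | _ b ih =>
    match b with
    | 0 => simp [mixedSum, rootEval_powerSum]; ring
    | 1 => simp [mixedSum, rootEval_powerSum]; ring
    | b + 2 =>
      rw [mixedSum]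
      simp only [map_sub, map_neg, map_add, map_mul, ih (b + 1) (by lia), ih b (by lia),
        rootEval_X_zero, rootEval_X_two, rootEval_X_three]
      ring

/-- The sum of `h₀ᵇ αᵇ βᵇ` over all unordered pairs of distinct roots, written as a difference of
two polynomials with nonnegative coefficients. -/
def pairSum : ℕ → MvPolynomial (Fin 4) ℤ × MvPolynomial (Fin 4) ℤ
  | 0 => ((3 : ℕ), (0 : ℕ))
  | 1 => ((0 : ℕ), X 2)
  | 2 => (X 2 * X 2, ((2 : ℕ) : MvPolynomial (Fin 4) ℤ) * (X 1 * X 3))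
  | n + 3 =>
    (X 2 * (pairSum (n + 2)).2 + X 1 * X 3 * (pairSum (n + 1)).2 + X 3 * X 3 * X 0 * (pairSum n).1,
      X 2 * (pairSum (n + 2)).1 + X 1 * X 3 * (pairSum (n + 1)).1
        + X 3 * X 3 * X 0 * (pairSum n).2)

lemma rootEval_pairSum {K : Type*} [CommRing K] (h α β γ : K) (b : ℕ) :
    rootEval h α β γ (pairSum b).1 - rootEval h α β γ (pairSum b).2 =
      h ^ b * ((α * β) ^ b + (α * γ) ^ b + (β * γ) ^ b) := by
  induction b using Nat.strong_induction_on with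
  | _ b ih =>
    match b with
    | 0 => simp [pairSum]; norm_num
    | 1 => simp [pairSum]
    | 2 => simp [pairSum]; ring
    | n + 3 =>
      have h₂ := ih (n + 2) (by lia)
      have h₁ := ih (n + 1) (by lia)
      have h₀ := ih n (by lia)
      rw [pairSum]
      simp only [map_add, map_mul,
        rootEval_X_zero, rootEval_X_one, rootEval_X_two, rootEval_X_three]
      linear_combination (h * (α * β + α * γ + β * γ)) * h₂
        - (h * (α + β + γ) * (h * (α * β * γ))) * h₁ + h * (h * (α * β * γ)) ^ 2 * h₀

lemma mixedSum_eq_sub (b c : ℕ) :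
    mixedSum b c = ((pairSum b).1 * powerSum (b + c)) -
      ((pairSum b).2 * powerSum (b + c) + (X 3 * X 0) ^ b * powerSum c) := by
  refine eq_of_rootEval_eq fun K _ h α β γ => ?_
  have := rootEval_pairSum h α β γ b
  simp only [map_sub, map_add, map_mul, map_pow, rootEval_powerSum, rootEval_mixedSum,
    rootEval_X_zero, rootEval_X_three]
  linear_combination (-(h ^ (b + c) * (α ^ (b + c) + β ^ (b + c) + γ ^ (b + c)))) * this

lemma mixedSum_add_eight (b c : ℕ) :
    mixedSum (b + 8) c =
      (X 2 ^ 4 - 4 * X 1 * X 2 ^ 2 * X 3 + 2 * X 1 ^ 2 * X 3 ^ 2 - 4 * X 0 * X 2 * X 3 ^ 2)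
          * (X 1 ^ 2 + X 2 * X 0) * mixedSum (b + 4) (c + 2)
        + (X 2 ^ 4 - 4 * X 1 * X 2 ^ 2 * X 3 + 2 * X 1 ^ 2 * X 3 ^ 2 - 4 * X 0 * X 2 * X 3 ^ 2)
          * (X 1 * X 2 * X 0 + X 3 * X 0 ^ 2) * mixedSum (b + 4) (c + 1)
        + ((X 2 ^ 4 - 4 * X 1 * X 2 ^ 2 * X 3 + 2 * X 1 ^ 2 * X 3 ^ 2 - 4 * X 0 * X 2 * X 3 ^ 2)
          * (X 1 * X 3 * X 0 ^ 2) - (X 3 * X 0) ^ 4) * mixedSum (b + 4) c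
        - X 3 ^ 4 * mixedSum b (c + 12) := by
  refine eq_of_rootEval_eq fun K _ h α β γ => ?_
  simp only [map_sub, map_add, map_mul, map_pow, rootEval_mixedSum, rootEval_two, rootEval_four,
    rootEval_X_zero, rootEval_X_one, rootEval_X_two, rootEval_X_three]
  set e₁ := h * (α + β + γ) with he₁
  set e₂ := -(h * (α * β + α * γ + β * γ)) with he₂
  set e₃ := h * (α * β * γ) with he₃
  set u := e₂ ^ 4 - 4 * e₁ * e₂ ^ 2 * e₃ + 2 * e₁ ^ 2 * e₃ ^ 2 - 4 * h * e₂ * e₃ ^ 2 with hu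
  have hu' : u = h ^ 4 * ((α * β) ^ 4 + (α * γ) ^ 4 + (β * γ) ^ 4) := by
    rw [hu, he₁, he₂, he₃]
    ring
  have key : ∀ x y z : K, e₁ = h * (x + y + z) → e₂ = -(h * (x * y + x * z + y * z)) →
      e₃ = h * (x * y * z) → u = h ^ 4 * ((x * y) ^ 4 + (x * z) ^ 4 + (y * z) ^ 4) →
      h ^ (2 * (b + 8) + c) * x ^ (2 * (b + 8) + c) * y ^ (b + 8) =
        u * (e₁ ^ 2 + e₂ * h) * (h ^ (2 * (b + 4) + (c + 2)) * x ^ (2 * (b + 4) + (c + 2)) *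
          y ^ (b + 4))
        + u * (e₁ * e₂ * h + e₃ * h ^ 2) * (h ^ (2 * (b + 4) + (c + 1)) *
          x ^ (2 * (b + 4) + (c + 1)) * y ^ (b + 4))
        + (u * (e₁ * e₃ * h ^ 2) - (e₃ * h) ^ 4) * (h ^ (2 * (b + 4) + c) *
          x ^ (2 * (b + 4) + c) * y ^ (b + 4))
        - e₃ ^ 4 * (h ^ (2 * b + (c + 12)) * x ^ (2 * b + (c + 12)) * y ^ b) := by
    intro x y z h₁ h₂ h₃ h₄
    have hx : (e₁ ^ 2 + e₂ * h) * (h * x) ^ 2 + (e₁ * e₂ * h + e₃ * h ^ 2) * (h * x)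
        + e₁ * e₃ * h ^ 2 = (h * x) ^ 4 := by
      rw [h₁, h₂, h₃]
      ring
    have hy : u * (h * x) ^ 4 * (h ^ 2 * x ^ 2 * y) ^ 4 = (h ^ 2 * x ^ 2 * y) ^ 8
        + (e₃ * h) ^ 4 * (h ^ 2 * x ^ 2 * y) ^ 4 + e₃ ^ 4 * (h * x) ^ 12 := by
      rw [h₃, h₄]
      ring
    have hpow : ∀ i, h ^ (2 * b + c + i) * x ^ (2 * b + c + i) =
        h ^ (2 * b + c) * x ^ (2 * b + c) * (h * x) ^ i := fun i => by ring
    rw [show 2 * (b + 8) + c = 2 * b + c + 16 by ring,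
      show 2 * (b + 4) + (c + 2) = 2 * b + c + 10 by ring,
      show 2 * (b + 4) + (c + 1) = 2 * b + c + 9 by ring,
      show 2 * (b + 4) + c = 2 * b + c + 8 by ring,
      show 2 * b + (c + 12) = 2 * b + c + 12 by ring]
    simp only [hpow, pow_add y]
    linear_combination -(h ^ (2 * b + c) * x ^ (2 * b + c) * y ^ b) * hy
      - u * (h ^ (2 * b + c) * x ^ (2 * b + c) * y ^ b) * (h ^ 2 * x ^ 2 * y) ^ 4 * hx
  have k₁ := key α β γ he₁ he₂ he₃ hu'
  have k₂ := key α γ β (by rw [he₁]; ring) (by rw [he₂]; ring) (by rw [he₃]; ring)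
    (by rw [hu']; ring)
  have k₃ := key β α γ (by rw [he₁]; ring) (by rw [he₂]; ring) (by rw [he₃]; ring)
    (by rw [hu']; ring)
  have k₄ := key β γ α (by rw [he₁]; ring) (by rw [he₂]; ring) (by rw [he₃]; ring)
    (by rw [hu']; ring)
  have k₅ := key γ α β (by rw [he₁]; ring) (by rw [he₂]; ring) (by rw [he₃]; ring)
    (by rw [hu']; ring)
  have k₆ := key γ β α (by rw [he₁]; ring) (by rw [he₂]; ring) (by rw [he₃]; ring)
    (by rw [hu']; ring)
  clear_value e₁ e₂ e₃ u
  clear hu hu' he₁ he₂ he₃ key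
  linear_combination k₁ + k₂ + k₃ + k₄ + k₅ + k₆

lemma coeffNonneg_powerSum (n : ℕ) : CoeffNonneg (powerSum n) := by
  have hX := fun i : Fin 4 => coeffNonneg_X (σ := Fin 4) i
  induction n using Nat.strong_induction_on with
  | _ n ih =>
    match n with
    | 0 => exact coeffNonneg_natCast 3
    | 1 => exact hX 1
    | 2 => exact ((hX 1).mul (hX 1)).add ((coeffNonneg_natCast 2).mul ((hX 2).mul (hX 0)))
    | n + 3 =>
      rw [powerSum]
      exact (((hX 1).mul (ih _ (by lia))).add (((hX 2).mul (hX 0)).mul (ih _ (by lia)))).add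
        ((((hX 3).mul (hX 0)).mul (hX 0)).mul (ih _ (by lia)))

lemma coeffNonneg_pairSum (n : ℕ) :
    CoeffNonneg (pairSum n).1 ∧ CoeffNonneg (pairSum n).2 := by
  have hX := fun i : Fin 4 => coeffNonneg_X (σ := Fin 4) i
  induction n using Nat.strong_induction_on with
  | _ n ih =>
    match n with
    | 0 => exact ⟨coeffNonneg_natCast 3, coeffNonneg_natCast 0⟩
    | 1 => exact ⟨coeffNonneg_natCast 0, hX 2⟩
    | 2 => exact ⟨(hX 2).mul (hX 2), (coeffNonneg_natCast 2).mul ((hX 1).mul (hX 3))⟩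
    | n + 3 =>
      obtain ⟨h₂, h₂'⟩ := ih (n + 2) (by lia)
      obtain ⟨h₁, h₁'⟩ := ih (n + 1) (by lia)
      obtain ⟨h₀, h₀'⟩ := ih n (by lia)
      rw [pairSum]
      exact ⟨(((hX 2).mul h₂').add (((hX 1).mul (hX 3)).mul h₁')).add
          ((((hX 3).mul (hX 3)).mul (hX 0)).mul h₀),
        (((hX 2).mul h₂).add (((hX 1).mul (hX 3)).mul h₁)).add
          ((((hX 3).mul (hX 3)).mul (hX 0)).mul h₀')⟩

/-- The sums of the coefficients of the two components of `pairSum`. -/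
def pairSumNorm : ℕ → ℕ × ℕ
  | 0 => (3, 0)
  | 1 => (0, 1)
  | 2 => (1, 2)
  | n + 3 => ((pairSumNorm (n + 2)).2 + (pairSumNorm (n + 1)).2 + (pairSumNorm n).1,
      (pairSumNorm (n + 2)).1 + (pairSumNorm (n + 1)).1 + (pairSumNorm n).2)

lemma mulBound_pairSum (n : ℕ) :
    MulBound (pairSum n).1 (pairSumNorm n).1 ∧ MulBound (pairSum n).2 (pairSumNorm n).2 := by
  have hX := fun i : Fin 4 => mulBound_X (σ := Fin 4) i
  induction n using Nat.strong_induction_on with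
  | _ n ih =>
    match n with
    | 0 => exact ⟨mulBound_natCast 3, mulBound_natCast 0⟩
    | 1 => exact ⟨mulBound_natCast 0, by simpa [pairSum, pairSumNorm] using hX 2⟩
    | 2 =>
      have h₁ := (hX 2).mul (hX 2)
      have h₂ := (mulBound_natCast 2).mul ((hX 1).mul (hX 3))
      rw [one_mul] at h₁ h₂
      exact ⟨by simpa [pairSum, pairSumNorm] using h₁, by simpa [pairSum, pairSumNorm] using h₂⟩
    | n + 3 =>
      obtain ⟨h₂, h₂'⟩ := ih (n + 2) (by lia)
      obtain ⟨h₁, h₁'⟩ := ih (n + 1) (by lia)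
      obtain ⟨h₀, h₀'⟩ := ih n (by lia)
      have k := (((hX 2).mul h₂').add (((hX 1).mul (hX 3)).mul h₁')).add
          ((((hX 3).mul (hX 3)).mul (hX 0)).mul h₀)
      have k' := (((hX 2).mul h₂).add (((hX 1).mul (hX 3)).mul h₁)).add
          ((((hX 3).mul (hX 3)).mul (hX 0)).mul h₀')
      simp only [one_mul] at k k'
      rw [pairSum, pairSumNorm]
      push_cast
      exact ⟨k, k'⟩

lemma pairSumNorm_le {b : ℕ} (hb : 1 ≤ b) (hb' : b ≤ 8) :
    ((pairSumNorm b).1 : ℝ) ≤ (90 / 49) ^ b ∧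
      ((pairSumNorm b).2 : ℝ) * (90 / 49) ^ b + 1 ≤ (90 / 49) ^ (2 * b) := by
  interval_cases b <;> norm_num [pairSumNorm]

lemma coeffBound_mixedSum_of_le_eight {A : ℝ} {n : ℕ}
    (H : ∀ m ≤ n, CoeffBound (powerSum m) ((90 / 49) ^ m * A)) {b c : ℕ} (hb : 1 ≤ b)
    (hb' : b ≤ 8) (hn : 2 * b + c ≤ n) :
    CoeffBound (mixedSum b c) ((90 / 49) ^ (2 * b + c) * A) := by
  have hA : 0 ≤ A := by simpa using (H 0 n.zero_le).nonneg
  obtain ⟨h₁, h₂⟩ := pairSumNorm_le hb hb'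
  obtain ⟨m₁, m₂⟩ := mulBound_pairSum b
  obtain ⟨n₁, n₂⟩ := coeffNonneg_pairSum b
  have nP := coeffNonneg_powerSum
  have hC : (0 : ℝ) ≤ (90 / 49) ^ c * A := by positivity
  rw [mixedSum_eq_sub]
  refine CoeffBound.sub_of_nonneg ?_ ?_ (n₁.mul (nP _))
    ((n₂.mul (nP _)).add ((((coeffNonneg_X 3).mul (coeffNonneg_X 0)).pow b).mul (nP c)))
  · refine (m₁ _ _ (H (b + c) (by lia))).mono ?_
    calc _ ≤ (90 / 49 : ℝ) ^ b * ((90 / 49) ^ (b + c) * A) := by gcongr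
      _ = _ := by ring
  · refine ((m₂ _ _ (H (b + c) (by lia))).add
      ((((mulBound_X 3).mul (mulBound_X 0)).pow b) _ _ (H c (by lia)))).mono ?_
    calc _ = ((pairSumNorm b).2 * (90 / 49) ^ b + 1) * ((90 / 49) ^ c * A) := by
            rw [one_mul, one_pow]
            ring
      _ ≤ (90 / 49) ^ (2 * b) * ((90 / 49) ^ c * A) := by gcongr
      _ = _ := by ring

lemma coeffBound_mixedSum {A : ℝ} {n : ℕ}
    (H : ∀ m ≤ n, CoeffBound (powerSum m) ((90 / 49) ^ m * A)) {b c : ℕ} (hb : 1 ≤ b)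
    (hn : 2 * b + c ≤ n) : CoeffBound (mixedSum b c) ((90 / 49) ^ (2 * b + c) * A) := by
  have hA : 0 ≤ A := by simpa using (H 0 n.zero_le).nonneg
  induction b using Nat.strong_induction_on generalizing c with
  | _ b ih =>
    rcases le_or_gt b 8 with hb' | hb'
    · exact coeffBound_mixedSum_of_le_eight H hb hb' hn
    · obtain ⟨d, rfl⟩ : ∃ d, b = d + 8 := ⟨b - 8, by lia⟩
      have hX := fun (i : Fin 4) (k : ℕ) => (mulBound_X i).pow k
      have N := fun k : ℕ => mulBound_natCast (σ := Fin 4) k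
      have c₁ : MulBound ((X 2 ^ 4 - 4 * X 1 * X 2 ^ 2 * X 3 + 2 * X 1 ^ 2 * X 3 ^ 2
          - 4 * X 0 * X 2 * X 3 ^ 2) * (X 1 ^ 2 + X 2 * X 0) : MvPolynomial (Fin 4) ℤ) 18 := by
        convert (((((((hX 1 2).mul (hX 2 4)).sub
          ((N 4).mul ((hX 1 3).mul ((hX 2 2).mul (hX 3 1))))).add
          ((N 2).mul ((hX 1 4).mul (hX 3 2)))).add
          ((hX 0 1).mul (hX 2 5))).sub
          ((N 4).mul ((hX 0 1).mul ((hX 1 1).mul ((hX 2 3).mul (hX 3 1)))))).sub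
          ((N 2).mul ((hX 0 1).mul ((hX 1 2).mul ((hX 2 1).mul (hX 3 2)))))).sub
          ((N 4).mul ((hX 0 2).mul ((hX 2 2).mul (hX 3 2)))) using 1
        · simp
          ring
        · norm_num
      have c₂ : MulBound ((X 2 ^ 4 - 4 * X 1 * X 2 ^ 2 * X 3 + 2 * X 1 ^ 2 * X 3 ^ 2
          - 4 * X 0 * X 2 * X 3 ^ 2) * (X 1 * X 2 * X 0 + X 3 * X 0 ^ 2) :
            MvPolynomial (Fin 4) ℤ) 22 := by
        convert ((((((((hX 0 1).mul ((hX 1 1).mul (hX 2 5))).sub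
          ((N 4).mul ((hX 0 1).mul ((hX 1 2).mul ((hX 2 3).mul (hX 3 1)))))).add
          ((N 2).mul ((hX 0 1).mul ((hX 1 3).mul ((hX 2 1).mul (hX 3 2)))))).sub
          ((N 8).mul ((hX 0 2).mul ((hX 1 1).mul ((hX 2 2).mul (hX 3 2)))))).add
          ((hX 0 2).mul ((hX 2 4).mul (hX 3 1)))).add
          ((N 2).mul ((hX 0 2).mul ((hX 1 2).mul (hX 3 3))))).sub
          ((N 4).mul ((hX 0 3).mul ((hX 2 1).mul (hX 3 3))))) using 1
        · simp
          ring
        · norm_num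
      have c₃ : MulBound ((X 2 ^ 4 - 4 * X 1 * X 2 ^ 2 * X 3 + 2 * X 1 ^ 2 * X 3 ^ 2
          - 4 * X 0 * X 2 * X 3 ^ 2) * (X 1 * X 3 * X 0 ^ 2) - (X 3 * X 0) ^ 4 :
            MvPolynomial (Fin 4) ℤ) 12 := by
        convert ((((hX 2 4).sub ((N 4).mul ((hX 1 1).mul ((hX 2 2).mul (hX 3 1))))).add
          ((N 2).mul ((hX 1 2).mul (hX 3 2)))).sub
          ((N 4).mul ((hX 0 1).mul ((hX 2 1).mul (hX 3 2))))).mul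
          ((hX 1 1).mul ((hX 3 1).mul (hX 0 2))) |>.sub ((hX 3 4).mul (hX 0 4)) using 1
        · simp
          ring
        · norm_num
      have c₄ : MulBound (X 3 ^ 4 : MvPolynomial (Fin 4) ℤ) 1 := by simpa using hX 3 4
      rw [mixedSum_add_eight]
      refine ((((c₁ _ _ (ih (d + 4) (by lia) (by lia) (by lia))).add
        (c₂ _ _ (ih (d + 4) (by lia) (by lia) (by lia)))).add
        (c₃ _ _ (ih (d + 4) (by lia) (by lia) (by lia)))).sub
        (c₄ _ _ (ih d (by lia) (by lia) (by lia)))).mono ?_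
      have hB : (0 : ℝ) ≤ (90 / 49) ^ (2 * d + c) * A := by positivity
      calc _ = (18 * (90 / 49) ^ 10 + 22 * (90 / 49) ^ 9 + 12 * (90 / 49) ^ 8 + (90 / 49) ^ 12) *
            ((90 / 49 : ℝ) ^ (2 * d + c) * A) := by ring
        _ ≤ (90 / 49) ^ 16 * ((90 / 49) ^ (2 * d + c) * A) := by
            gcongr
            norm_num
        _ = _ := by ring

lemma height_powerSum_le_succ {n : ℕ} (hn : 1000001 ≤ n) :
    1.838 * (height (powerSum n) : ℝ) ≤ height (powerSum (n + 1)) := by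
  obtain ⟨m, rfl⟩ : ∃ m, n = m + 1 := ⟨n - 1, by lia⟩
  exact height_powerSum_succ m (by lia)

lemma height_powerSum_add {n : ℕ} (hn : 1000001 ≤ n) (d : ℕ) :
    1.838 ^ d * (height (powerSum n) : ℝ) ≤ height (powerSum (n + d)) := by
  induction d with
  | zero => simp
  | succ d ih =>
    calc _ = 1.838 * (1.838 ^ d * (height (powerSum n) : ℝ)) := by ring
      _ ≤ 1.838 * (height (powerSum (n + d)) : ℝ) := by gcongr
      _ ≤ _ := height_powerSum_le_succ (by lia)

lemma exists_forall_height_powerSum_le :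
    ∃ N : ℕ, ∀ n, N ≤ n → 1 ≤ n ∧ ∀ m ≤ n,
      CoeffBound (powerSum m) ((90 / 49) ^ m * (height (powerSum n) / (90 / 49) ^ n)) := by
  obtain ⟨N₀, hN₀⟩ : ∃ N₀, 1000001 ≤ N₀ := ⟨_, le_rfl⟩
  set B : ℝ := ∑ m ∈ Finset.range N₀, (height (powerSum m) : ℝ)
  have hlim : Filter.Tendsto (fun d : ℕ => (1.838 / (90 / 49) : ℝ) ^ d) Filter.atTop
      Filter.atTop := tendsto_pow_atTop_atTop_of_one_lt (by norm_num)
  obtain ⟨D, hD⟩ := (hlim.eventually_ge_atTop (B * (90 / 49) ^ N₀)).exists_forall_of_atTop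
  refine ⟨N₀ + D, fun n hn => ⟨by lia, fun m hm => ?_⟩⟩
  refine (coeffBound_height _).mono ?_
  have hpos : (0 : ℝ) < (90 / 49) ^ n := by positivity
  rw [← mul_div_assoc, le_div_iff₀ hpos]
  rcases le_or_gt N₀ m with h | h
  · obtain ⟨d, rfl⟩ := Nat.exists_eq_add_of_le hm
    have := height_powerSum_add (hN₀.trans h) d
    calc _ = (90 / 49) ^ m * ((90 / 49) ^ d * (height (powerSum m) : ℝ)) := by ring
      _ ≤ (90 / 49) ^ m * (1.838 ^ d * (height (powerSum m) : ℝ)) := by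
          gcongr
          norm_num
      _ ≤ _ := by gcongr
  · obtain ⟨d, rfl⟩ := Nat.exists_eq_add_of_le (show N₀ ≤ n by lia)
    have h₁ := height_powerSum_add hN₀ d
    have h₂ := hD d (by lia)
    have h₃ : (height (powerSum m) : ℝ) ≤ B :=
      Finset.single_le_sum (f := fun m => (height (powerSum m) : ℝ)) (fun i _ => by positivity)
        (Finset.mem_range.2 h)
    have h₄ : (1 : ℝ) ≤ height (powerSum N₀) := by
      have := height_powerSum_pos (N₀ - 1)
      rw [Nat.sub_add_cancel (by lia)] at this
      exact_mod_cast this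
    rw [div_pow (1.838 : ℝ) (90 / 49) d, le_div_iff₀ (by positivity)] at h₂
    calc _ ≤ B * (90 / 49) ^ (N₀ + d) := by gcongr
      _ = B * (90 / 49) ^ N₀ * (90 / 49) ^ d := by ring
      _ ≤ 1.838 ^ d * 1 := by linarith
      _ ≤ 1.838 ^ d * height (powerSum N₀) := by gcongr
      _ ≤ height (powerSum (N₀ + d)) := h₁
      _ = 1 * height (powerSum (N₀ + d)) := (one_mul _).symm
      _ ≤ _ := by
        gcongr
        exact one_le_pow₀ (by norm_num)

/-- The reversal of the variables, with signs. -/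
def signedRev (ε : Fin 4 → ℤ) : MvPolynomial (Fin 4) ℤ →ₐ[ℤ] MvPolynomial (Fin 4) ℤ :=
  aeval fun i => C (ε i) * X i.rev

lemma signedRev_monomial (ε : Fin 4 → ℤ) (s : Fin 4 →₀ ℕ) (a : ℤ) :
    signedRev ε (monomial s a) =
      monomial (s.mapDomain Fin.rev) ((s.prod fun i k => ε i ^ k) * a) := by
  have h : (s.prod fun i k => (X i.rev : MvPolynomial (Fin 4) ℤ) ^ k) =
      rename Fin.rev (monomial s 1) := by
    rw [monomial_eq, map_mul, rename_C, C_1, one_mul, map_finsuppProd]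
    simp
  rw [signedRev, aeval_monomial]
  simp only [mul_pow, Finsupp.prod_mul]
  rw [h, rename_monomial]
  simp only [← map_pow, Finsupp.prod, ← map_prod]
  rw [algebraMap_eq, C_mul_monomial, C_mul_monomial]
  congr 1
  ring

lemma coeff_signedRev (ε : Fin 4 → ℤ) (p : MvPolynomial (Fin 4) ℤ) (s : Fin 4 →₀ ℕ) :
    coeff (s.mapDomain Fin.rev) (signedRev ε p) = (s.prod fun i k => ε i ^ k) * coeff s p := by
  classical
  induction p using MvPolynomial.induction_on' with
  | monomial u a =>
    rw [signedRev_monomial, coeff_monomial, coeff_monomial]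
    by_cases h : u = s
    · rw [if_pos h, if_pos (by rw [h]), h]
    · rw [if_neg h, if_neg, mul_zero]
      exact fun h' => h (Finsupp.mapDomain_injective Fin.rev_injective h')
  | add p q hp hq => rw [map_add, coeff_add, hp, hq, coeff_add, mul_add]

lemma abs_coeff_signedRev {ε : Fin 4 → ℤ} (hε : ∀ i, |ε i| = 1) (p : MvPolynomial (Fin 4) ℤ)
    (s : Fin 4 →₀ ℕ) : |coeff (s.mapDomain Fin.rev) (signedRev ε p)| = |coeff s p| := by
  rw [coeff_signedRev, abs_mul, Finsupp.prod, Finset.abs_prod]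
  simp [abs_pow, hε]

lemma coeffBound_signedRev {ε : Fin 4 → ℤ} (hε : ∀ i, |ε i| = 1) {p : MvPolynomial (Fin 4) ℤ}
    {r : ℝ} : CoeffBound (signedRev ε p) r ↔ CoeffBound p r := by
  have key : ∀ s, |((coeff (s.mapDomain Fin.rev) (signedRev ε p) : ℤ) : ℝ)| =
      |((coeff s p : ℤ) : ℝ)| := fun s => by
    exact_mod_cast abs_coeff_signedRev hε p s
  refine ⟨fun h s => (key s).symm.trans_le (h _), fun h s => ?_⟩
  have hs : (s.mapDomain Fin.rev).mapDomain Fin.rev = s := by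
    rw [← Finsupp.mapDomain_comp, Fin.rev_involutive.comp_self, Finsupp.mapDomain_id]
  rw [← hs, key]
  exact h _

/-- The polynomial `h₀ᵃ ∑ αᵃ βᵇ`, where the sum runs over the distinct monomials obtained from
`αᵃ βᵇ` by permuting the roots `α`, `β`, `γ`, for `b ≤ a`. -/
def orbitSum (a b : ℕ) : MvPolynomial (Fin 4) ℤ :=
  if a = 0 then 1
  else if b = 0 then powerSum a
  else if b = a then signedRev ![1, -1, -1, 1] (powerSum a)
  else if 2 * b ≤ a then mixedSum b (a - 2 * b)
  else signedRev ![1, -1, -1, 1] (mixedSum (a - b) (2 * b - a))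

lemma rootEval_signedRev {K : Type*} [Field K] (h : K) {α β γ : K} (hα : α ≠ 0) (hβ : β ≠ 0)
    (hγ : γ ≠ 0) (p : MvPolynomial (Fin 4) ℤ) :
    rootEval h α β γ (signedRev ![1, -1, -1, 1] p) =
      rootEval (h * (α * β * γ)) α⁻¹ β⁻¹ γ⁻¹ p := by
  have : (rootEval h α β γ).comp (signedRev ![1, -1, -1, 1]) =
      rootEval (h * (α * β * γ)) α⁻¹ β⁻¹ γ⁻¹ := by
    apply MvPolynomial.algHom_ext
    intro i
    fin_cases i <;> simp [signedRev, Fin.rev] <;> field_simp <;> ring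
  exact congrArg (fun f : MvPolynomial (Fin 4) ℤ →ₐ[ℤ] K => f p) this

lemma rootEval_orbitSum {K : Type*} [Field K] (h : K) {α β γ : K} (hα : α ≠ 0) (hβ : β ≠ 0)
    (hγ : γ ≠ 0) {a b : ℕ} (hba : b ≤ a) :
    rootEval h α β γ (orbitSum a b) = h ^ a *
      (γ ^ a * β ^ b + (if b < a then β ^ a * γ ^ b else 0) + (if 0 < b then γ ^ a * α ^ b else 0)
        + (if b < a then α ^ a * γ ^ b else 0) + (if 0 < b then β ^ a * α ^ b else 0)
        + (if 0 < b ∧ b < a then α ^ a * β ^ b else 0)) := by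
  rcases Nat.eq_zero_or_pos b with rfl | hb
  · rcases Nat.eq_zero_or_pos a with rfl | ha
    · simp [orbitSum]
    · simp only [orbitSum, ha.ne', if_true, if_false, rootEval_powerSum, pow_zero, mul_one, ha,
        lt_irrefl, false_and, add_zero]
      ring
  rcases hba.eq_or_lt with rfl | hba
  · simp only [orbitSum, hb.ne', if_true, if_false, rootEval_powerSum, lt_irrefl, and_false, hb,
      add_zero, rootEval_signedRev h hα hβ hγ, inv_pow, mul_pow]
    field_simp
  rw [orbitSum, if_neg (by lia), if_neg hb.ne', if_neg hba.ne, if_pos hba, if_pos hb,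
    if_pos (show 0 < b ∧ b < a from ⟨hb, hba⟩)]
  split_ifs with h₁
  · obtain ⟨c, rfl⟩ := Nat.exists_eq_add_of_le h₁
    rw [Nat.add_sub_cancel_left, rootEval_mixedSum]
    ring
  · obtain ⟨d, rfl⟩ := Nat.exists_eq_add_of_le hba.le
    obtain ⟨c, rfl⟩ := Nat.exists_eq_add_of_le (show d ≤ b by lia)
    rw [show 2 * (d + c) - (d + c + d) = c by lia, Nat.add_sub_cancel_left,
      rootEval_signedRev h hα hβ hγ, rootEval_mixedSum]
    simp only [mul_pow, inv_pow]
    field_simp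
    ring

lemma coeffBound_orbitSum {A : ℝ} {n : ℕ} (hA : 1 ≤ A * (90 / 49) ^ n)
    (H : ∀ m ≤ n, CoeffBound (powerSum m) ((90 / 49) ^ m * A)) {a b : ℕ} (hba : b ≤ a)
    (han : a ≤ n) : CoeffBound (orbitSum a b) ((90 / 49) ^ n * A) := by
  have hA : 0 ≤ A := by simpa using (H 0 n.zero_le).nonneg
  have hpow : (90 / 49 : ℝ) ^ a * A ≤ (90 / 49) ^ n * A := by
    gcongr
    norm_num
  have hε : ∀ i, |(![1, -1, -1, 1] : Fin 4 → ℤ) i| = 1 := by decide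
  rw [orbitSum]
  split_ifs with h₁ h₂ h₃ h₄
  · exact coeffBound_one.mono (by linarith)
  · exact (H a han).mono hpow
  · exact (coeffBound_signedRev hε).2 ((H a han).mono hpow)
  · have := coeffBound_mixedSum H (b := b) (c := a - 2 * b) (by lia) (by lia)
    rw [show 2 * b + (a - 2 * b) = a by lia] at this
    exact this.mono hpow
  · have := coeffBound_mixedSum H (b := a - b) (c := 2 * b - a) (by lia) (by lia)
    rw [show 2 * (a - b) + (2 * b - a) = a by lia] at this
    exact (coeffBound_signedRev hε).2 (this.mono hpow)

lemma sum_triple_eq_sum_sorted {ι M : Type*} [Fintype ι] [LinearOrder ι] [AddCommMonoid M]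
    (F : ι → ι → ι → M) :
    ∑ i, ∑ j, ∑ k, F i j k = ∑ i, ∑ j, ∑ k, if i ≤ j ∧ j ≤ k then
      F i j k + (if j < k then F i k j else 0) + (if i < j then F j i k else 0)
        + (if j < k then F k i j else 0) + (if i < j then F j k i else 0)
        + (if i < j ∧ j < k then F k j i else 0) else 0 := by
  have hL : ∀ x y z, F x y z = (if x ≤ y ∧ y ≤ z then F x y z else 0)
      + (if x ≤ z ∧ z < y then F x y z else 0) + (if y < x ∧ x ≤ z then F x y z else 0)
      + (if y ≤ z ∧ z < x then F x y z else 0) + (if z < x ∧ x ≤ y then F x y z else 0)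
      + (if z < y ∧ y < x then F x y z else 0) := by
    intro x y z
    simp only [← not_le]
    by_cases h : x ≤ y <;> by_cases h' : y ≤ z <;> by_cases h'' : x ≤ z <;>
      first | order | simp [h, h', h'']
  have hR : ∀ i j k, (if i ≤ j ∧ j ≤ k then
      F i j k + (if j < k then F i k j else 0) + (if i < j then F j i k else 0)
        + (if j < k then F k i j else 0) + (if i < j then F j k i else 0)
        + (if i < j ∧ j < k then F k j i else 0) else 0) =
      (if i ≤ j ∧ j ≤ k then F i j k else 0) + (if i ≤ j ∧ j < k then F i k j else 0)
        + (if i < j ∧ j ≤ k then F j i k else 0) + (if i ≤ j ∧ j < k then F k i j else 0)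
        + (if i < j ∧ j ≤ k then F j k i else 0) + (if i < j ∧ j < k then F k j i else 0) := by
    intro i j k
    by_cases h : i ≤ j <;> by_cases h' : j ≤ k <;> by_cases h₁ : i < j <;>
      by_cases h₂ : j < k <;> first | order | simp [h, h', h₁, h₂]
  simp_rw [hR]
  conv_lhs =>
    enter [2, i, 2, j, 2, k]
    rw [hL]
  simp only [Finset.sum_add_distrib]
  congr 1; congr 1; congr 1; congr 1; congr 1
  · exact Finset.sum_congr rfl fun _ _ => Finset.sum_comm
  · exact Finset.sum_comm
  · rw [Finset.sum_comm]
    exact Finset.sum_congr rfl fun _ _ => Finset.sum_comm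
  · rw [Finset.sum_congr rfl fun _ _ => Finset.sum_comm]
    exact Finset.sum_comm
  · rw [Finset.sum_comm, Finset.sum_congr rfl fun _ _ => Finset.sum_comm, Finset.sum_comm]

/-- The image in `K[x]` of the generic polynomial with the given coefficients. -/
def genPoly {K : Type*} [CommRing K] {n : ℕ} (c : Fin (n + 1) → K) : Polynomial K :=
  ∑ i, Polynomial.C (c i) * Polynomial.X ^ (i : ℕ)

lemma coeff_genPoly {K : Type*} [CommRing K] {n : ℕ} (c : Fin (n + 1) → K) (i : ℕ) :
    (genPoly c).coeff i = if h : i < n + 1 then c ⟨i, h⟩ else 0 := by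
  simp only [genPoly, Polynomial.finsetSum_coeff, Polynomial.coeff_C_mul, Polynomial.coeff_X_pow,
    mul_ite, mul_one, mul_zero]
  split_ifs with h
  · rw [Finset.sum_eq_single ⟨i, h⟩]
    · simp
    · intro j _ hj
      rw [if_neg]
      rintro rfl
      exact hj rfl
    · simp
  · exact Finset.sum_eq_zero fun j _ => if_neg (by have := j.2; lia)

lemma natDegree_genPoly_le {K : Type*} [CommRing K] {n : ℕ} (c : Fin (n + 1) → K) :
    (genPoly c).natDegree ≤ n := by
  rw [Polynomial.natDegree_le_iff_coeff_eq_zero]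
  intro i hi
  rw [coeff_genPoly, dif_neg (by lia)]

lemma map_genRes (m n : ℕ) {K : Type*} [CommRing K]
    (φ : MvPolynomial (Fin (m + 1) ⊕ Fin (n + 1)) ℤ →+* K) :
    φ (genRes m n) = Polynomial.resultant (genPoly fun j => φ (X (Sum.inr j)))
      (genPoly fun i => φ (X (Sum.inl i))) n m := by
  rw [genRes, Polynomial.resultant, RingHom.map_det,
    ← Matrix.det_submatrix_equiv_self (finCongr (Nat.add_comm n m)) (φ.mapMatrix _)]
  congr 1
  ext i j
  rw [Matrix.submatrix_apply, RingHom.mapMatrix_apply, Matrix.map_apply]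
  induction j using Fin.addCases with
  | left j =>
    have hj := j.2
    simp only [sylvesterMatrix, Polynomial.sylvester, coeff_genPoly, Matrix.of_apply,
      finCongr_apply, Fin.val_cast, Fin.val_castAdd, hj, if_true, Fin.addCases_left, Set.mem_Icc]
    split_ifs <;> first | rfl | exact map_zero φ | lia
  | right j =>
    simp only [sylvesterMatrix, Polynomial.sylvester, coeff_genPoly, Matrix.of_apply,
      finCongr_apply, Fin.val_cast, Fin.val_natAdd, Fin.addCases_right, Set.mem_Icc,
      Nat.add_sub_cancel_left, show ¬ n + (j : ℕ) < n by lia, if_false]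
    split_ifs <;> first | rfl | exact map_zero φ | lia

lemma map_genRes_three (n : ℕ) {K : Type*} [Field K]
    (φ : MvPolynomial (Fin (3 + 1) ⊕ Fin (n + 1)) ℤ →+* K) {h α β γ : K} (hh : h ≠ 0)
    (h₃ : φ (X (Sum.inl 3)) = h) (h₂ : φ (X (Sum.inl 2)) = -(h * (α + β + γ)))
    (h₁ : φ (X (Sum.inl 1)) = h * (α * β + α * γ + β * γ))
    (h₀ : φ (X (Sum.inl 0)) = -(h * (α * β * γ))) :
    φ (genRes 3 n) = (-1) ^ (n * 3) * (h ^ n * ∑ i : Fin (n + 1), ∑ j : Fin (n + 1),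
      ∑ k : Fin (n + 1), φ (X (Sum.inr i) * X (Sum.inr j) * X (Sum.inr k)) *
        (α ^ (i : ℕ) * β ^ (j : ℕ) * γ ^ (k : ℕ))) := by
  set G := genPoly fun j => φ (X (Sum.inr j)) with hG
  have heval : ∀ x, G.eval x = ∑ i : Fin (n + 1), φ (X (Sum.inr i)) * x ^ (i : ℕ) := fun x => by
    simp [hG, genPoly, Polynomial.eval_finsetSum]
  set F := genPoly fun j => φ (X (Sum.inl j)) with hF
  have hF' : F = Polynomial.C h * (({α, β, γ} : Multiset K).map
      fun a => Polynomial.X - Polynomial.C a).prod := by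
    rw [hF, genPoly, Fin.sum_univ_four]
    simp [h₀, h₁, h₂, h₃]
    ring
  have hprod : Polynomial.Monic (({α, β, γ} : Multiset K).map
      fun a => Polynomial.X - Polynomial.C a).prod := Polynomial.monic_multiset_prod_of_monic _ _
    fun a _ => Polynomial.monic_X_sub_C a
  have hdeg : F.natDegree = 3 := by
    rw [hF', Polynomial.natDegree_C_mul hh, Polynomial.natDegree_multiset_prod_X_sub_C_eq_card]
    rfl
  have hlead : F.leadingCoeff = h := by
    rw [hF', Polynomial.leadingCoeff_mul, hprod.leadingCoeff, Polynomial.leadingCoeff_C, mul_one]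
  have hroots : F.roots = {α, β, γ} := by
    rw [hF', Polynomial.roots_C_mul _ hh, Polynomial.roots_multiset_prod_X_sub_C]
  have hsplit : F.Splits := by
    rw [hF']
    exact (Polynomial.Splits.C h).mul (Polynomial.Splits.multisetProd (by simp))
  have hres := Polynomial.resultant_eq_prod_eval F G n (natDegree_genPoly_le _) hsplit
  rw [map_genRes, Polynomial.resultant_comm, ← hG, ← hF]
  rw [hdeg, hlead, hroots] at hres
  rw [hres]
  simp only [Multiset.insert_eq_cons, Multiset.map_cons, Multiset.prod_cons,
    Multiset.map_singleton, Multiset.prod_singleton, heval]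
  congr 2
  rw [← mul_assoc, Finset.sum_mul_sum, Finset.sum_mul]
  refine Finset.sum_congr rfl fun i _ => ?_
  rw [Finset.sum_mul]
  refine Finset.sum_congr rfl fun j _ => ?_
  rw [Finset.mul_sum]
  refine Finset.sum_congr rfl fun k _ => ?_
  rw [map_mul, map_mul]
  ring

/-- The coefficient of `gᵢ gⱼ gₖ` in `h₀ⁿ g(α) g(β) g(γ)`, for `i ≤ j ≤ k`, where `α`, `β`, `γ`
are the roots of `h₀ x³ - h₁ x² - h₂ x - h₃`. -/
def resCoeff (n i j k : ℕ) : MvPolynomial (Fin 4) ℤ :=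
  X 3 ^ i * X 0 ^ (n - k) * orbitSum (k - i) (j - i)

lemma rootEval_resCoeff {K : Type*} [Field K] (h : K) {α β γ : K} (hα : α ≠ 0) (hβ : β ≠ 0)
    (hγ : γ ≠ 0) {n i j k : ℕ} (hij : i ≤ j) (hjk : j ≤ k) (hkn : k ≤ n) :
    rootEval h α β γ (resCoeff n i j k) = h ^ n *
      (α ^ i * β ^ j * γ ^ k + (if j < k then α ^ i * β ^ k * γ ^ j else 0)
        + (if i < j then α ^ j * β ^ i * γ ^ k else 0)
        + (if j < k then α ^ k * β ^ i * γ ^ j else 0)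
        + (if i < j then α ^ j * β ^ k * γ ^ i else 0)
        + (if i < j ∧ j < k then α ^ k * β ^ j * γ ^ i else 0)) := by
  obtain ⟨b, rfl⟩ := Nat.exists_eq_add_of_le hij
  obtain ⟨c, rfl⟩ := Nat.exists_eq_add_of_le hjk
  obtain ⟨d, rfl⟩ := Nat.exists_eq_add_of_le hkn
  rw [resCoeff, map_mul, map_mul, map_pow, map_pow, rootEval_X_zero, rootEval_X_three,
    rootEval_orbitSum h hα hβ hγ (by lia), show i + b + c - i = b + c by lia,
    Nat.add_sub_cancel_left, Nat.add_sub_cancel_left]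
  simp only [show i < i + b ↔ 0 < b by lia, show i + b < i + b + c ↔ b < b + c by lia, pow_add,
    mul_pow]
  split_ifs <;> ring

lemma coeffBound_resCoeff {A : ℝ} {n : ℕ} (hA : 1 ≤ A * (90 / 49) ^ n)
    (H : ∀ m ≤ n, CoeffBound (powerSum m) ((90 / 49) ^ m * A)) {i j k : ℕ} (hjk : j ≤ k)
    (hkn : k ≤ n) : CoeffBound (resCoeff n i j k) ((90 / 49) ^ n * A) := by
  have := (((mulBound_X 3).pow i).mul ((mulBound_X 0).pow (n - k))) _ _
    (coeffBound_orbitSum hA H (a := k - i) (b := j - i) (by lia) (by lia))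
  simpa [resCoeff] using this

/-- The signs turning the coefficients of `h₀ x³ - h₁ x² - h₂ x - h₃` into those of
`f₀ + f₁ x + f₂ x² + f₃ x³`. -/
def cubicSign : Fin 4 → ℤ := ![1, -1, -1, -1]

lemma abs_cubicSign (i : Fin 4) : |cubicSign i| = 1 := by
  fin_cases i <;> rfl

lemma genRes_three_eq (n : ℕ) :
    genRes 3 n = (-1) ^ (n * 3) * ∑ i : Fin (n + 1), ∑ j : Fin (n + 1), ∑ k : Fin (n + 1),
      if i ≤ j ∧ j ≤ k then rename Sum.inl (signedRev cubicSign (resCoeff n i j k)) *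
        (X (Sum.inr i) * X (Sum.inr j) * X (Sum.inr k)) else 0 := by
  obtain ⟨K, _, φ, α, β, γ, hφ, hα, hβ, hγ, h₂, h₁, h₀⟩ := exists_roots
    (D := MvPolynomial (Fin (3 + 1) ⊕ Fin (n + 1)) ℤ) (a := X (Sum.inl 3)) (b := -X (Sum.inl 2))
    (c := -X (Sum.inl 1)) (d := -X (Sum.inl 0)) (X_ne_zero _) (neg_ne_zero.2 (X_ne_zero _))
  rw [map_neg, neg_eq_iff_eq_neg] at h₀ h₂
  rw [map_neg, neg_inj] at h₁
  have hh : φ (X (Sum.inl 3)) ≠ 0 := (map_ne_zero_iff φ hφ).2 (X_ne_zero _)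
  have hroot : ∀ p, φ (rename Sum.inl (signedRev cubicSign p)) =
      rootEval (φ (X (Sum.inl 3))) α β γ p := by
    have : φ.toIntAlgHom.comp ((rename Sum.inl).comp (signedRev cubicSign)) =
        rootEval (φ (X (Sum.inl 3))) α β γ := by
      apply MvPolynomial.algHom_ext
      intro i
      change φ (rename Sum.inl (signedRev cubicSign (X i))) = _
      rw [signedRev, aeval_X, map_mul, rename_C, rename_X, map_mul]
      fin_cases i <;> simp [cubicSign, h₀, h₁, h₂]
    exact fun p => congrArg (fun f : MvPolynomial (Fin 4) ℤ →ₐ[ℤ] K => f p) this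
  apply hφ
  rw [map_genRes_three n φ hh rfl h₂ h₁ h₀, sum_triple_eq_sum_sorted, map_mul, map_pow, map_neg,
    map_one]
  congr 1
  simp only [map_sum, Finset.mul_sum]
  refine Finset.sum_congr rfl fun i _ => Finset.sum_congr rfl fun j _ =>
    Finset.sum_congr rfl fun k _ => ?_
  by_cases h : i ≤ j ∧ j ≤ k
  · rw [if_pos h, if_pos h, map_mul φ (rename _ _), hroot, rootEval_resCoeff _ hα hβ hγ h.1 h.2 k.is_le]
    simp only [← Fin.lt_def, map_mul]
    split_ifs <;> ring
  · rw [if_neg h, if_neg h, mul_zero, map_zero]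

lemma sumElim_inj {ι κ : Type*} {u u' : ι →₀ ℕ} {v v' : κ →₀ ℕ} :
    Finsupp.sumElim u v = Finsupp.sumElim u' v' ↔ u = u' ∧ v = v' := by
  refine ⟨fun h => ⟨?_, ?_⟩, by rintro ⟨rfl, rfl⟩; rfl⟩
  · ext i
    simpa using DFunLike.congr_fun h (Sum.inl i)
  · ext i
    simpa using DFunLike.congr_fun h (Sum.inr i)

lemma exists_eq_sumElim {ι κ : Type*} (s : ι ⊕ κ →₀ ℕ) : ∃ u v, s = Finsupp.sumElim u v := by
  obtain ⟨⟨u, v⟩, rfl⟩ := Finsupp.sumFinsuppEquivProdFinsupp.symm.surjective s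
  exact ⟨u, v, rfl⟩

lemma coeff_rename_inl_mul_monomial {ι κ R : Type*} [CommSemiring R] [DecidableEq κ]
    (p : MvPolynomial ι R) (u : ι →₀ ℕ) (v w : κ →₀ ℕ) :
    coeff (Finsupp.sumElim u v) (rename Sum.inl p * monomial (w.mapDomain Sum.inr) 1) =
      if v = w then coeff u p else 0 := by
  classical
  induction p using MvPolynomial.induction_on' with
  | monomial t a =>
    rw [rename_monomial, monomial_mul, ← Finsupp.sumElim_eq_add, coeff_monomial,
      coeff_monomial, mul_one]
    simp only [sumElim_inj]
    split_ifs <;> grind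
  | add p q hp hq =>
    rw [map_add, add_mul, coeff_add, hp, hq, coeff_add]
    split_ifs <;> simp

/-- The exponent of the monomial `gᵢ gⱼ gₖ`. -/
def tripleExp {ι : Type*} (i j k : ι) : ι →₀ ℕ :=
  Finsupp.single i 1 + Finsupp.single j 1 + Finsupp.single k 1

lemma X_mul_X_mul_X_eq_monomial {ι κ R : Type*} [CommSemiring R] (i j k : κ) :
    (X (Sum.inr i) * X (Sum.inr j) * X (Sum.inr k) : MvPolynomial (ι ⊕ κ) R) =
      monomial ((tripleExp i j k).mapDomain Sum.inr) 1 := by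
  simp only [tripleExp, Finsupp.mapDomain_add, Finsupp.mapDomain_single, X, monomial_mul, mul_one]

lemma tripleExp_inj {ι : Type*} [LinearOrder ι] {i j k i' j' k' : ι} (h : i ≤ j ∧ j ≤ k)
    (h' : i' ≤ j' ∧ j' ≤ k') (he : tripleExp i j k = tripleExp i' j' k') :
    i = i' ∧ j = j' ∧ k = k' := by
  have hm := congrArg Finsupp.toMultiset he
  simp only [tripleExp, map_add, Finsupp.toMultiset_single, one_smul] at hm
  have hp : [i, j, k].Perm [i', j', k'] := Multiset.coe_eq_coe.1 hm
  simpa using hp.eq_of_pairwise' (r := (· ≤ ·)) (by grind) (by grind)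

lemma coeff_genRes_three (n : ℕ) {i j k : Fin (n + 1)} (h : i ≤ j ∧ j ≤ k) (u : Fin 4 →₀ ℕ) :
    coeff (Finsupp.sumElim u (tripleExp i j k)) (genRes 3 n) =
      (-1) ^ (n * 3) * coeff u (signedRev cubicSign (resCoeff n i j k)) := by
  have hC : ((-1) ^ (n * 3) : MvPolynomial (Fin (3 + 1) ⊕ Fin (n + 1)) ℤ) =
    C ((-1) ^ (n * 3)) := by simp
  have key : ∀ i' j' k' : Fin (n + 1), coeff (Finsupp.sumElim u (tripleExp i j k))
      (if i' ≤ j' ∧ j' ≤ k' then rename Sum.inl (signedRev cubicSign (resCoeff n i' j' k')) *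
        (X (Sum.inr i') * X (Sum.inr j') * X (Sum.inr k')) else 0) =
      if k' = k ∧ j' = j ∧ i' = i then coeff u (signedRev cubicSign (resCoeff n i j k))
        else 0 := by
    intro i' j' k'
    by_cases h' : i' ≤ j' ∧ j' ≤ k'
    · rw [if_pos h', X_mul_X_mul_X_eq_monomial, coeff_rename_inl_mul_monomial]
      by_cases he : tripleExp i j k = tripleExp i' j' k'
      · obtain ⟨rfl, rfl, rfl⟩ := tripleExp_inj h h' he
        simp
      · rw [if_neg he, if_neg]
        rintro ⟨rfl, rfl, rfl⟩
        exact he rfl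
    · rw [if_neg h', coeff_zero, if_neg]
      rintro ⟨rfl, rfl, rfl⟩
      exact h' h
  rw [genRes_three_eq, hC, coeff_C_mul]
  simp only [coeff_sum, key]
  simp only [ite_and, Finset.sum_ite_eq', Finset.mem_univ, if_true]

lemma coeff_genRes_three_eq_zero (n : ℕ) {v : Fin (n + 1) →₀ ℕ}
    (h : ∀ i j k : Fin (n + 1), i ≤ j ∧ j ≤ k → v ≠ tripleExp i j k) (u : Fin 4 →₀ ℕ) :
    coeff (Finsupp.sumElim u v) (genRes 3 n) = 0 := by
  have hC : ((-1) ^ (n * 3) : MvPolynomial (Fin (3 + 1) ⊕ Fin (n + 1)) ℤ) =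
    C ((-1) ^ (n * 3)) := by simp
  rw [genRes_three_eq, hC, coeff_C_mul]
  simp only [coeff_sum]
  rw [Finset.sum_eq_zero, mul_zero]
  refine fun i _ => Finset.sum_eq_zero fun j _ => Finset.sum_eq_zero fun k _ => ?_
  by_cases h' : i ≤ j ∧ j ≤ k
  · rw [if_pos h', X_mul_X_mul_X_eq_monomial, coeff_rename_inl_mul_monomial, if_neg (h i j k h')]
  · rw [if_neg h', coeff_zero]

lemma toBinomial_monomial (m n : ℕ) (u : Fin (m + 1) →₀ ℕ) (v : Fin (n + 1) →₀ ℕ) (a : ℤ) :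
    toBinomial m n (monomial (Finsupp.sumElim u v) a) =
      if ∀ j, v j ≠ 0 → (j : ℕ) = 0 ∨ (j : ℕ) = n then monomial (Finsupp.sumElim u v) a else 0 := by
  rw [toBinomial, aeval_monomial]
  split_ifs with h
  · rw [monomial_eq, algebraMap_eq]
    congr 1
    refine Finset.prod_congr rfl fun x hx => ?_
    rcases x with x | x
    · rfl
    · rw [Finsupp.mem_support_iff, Finsupp.sumElim_inr] at hx
      simp only [if_pos (h x hx)]
  · push Not at h
    obtain ⟨j, hj, hj'⟩ := h
    have hj₀ : (Finsupp.sumElim u v) (Sum.inr j) ≠ 0 := by rwa [Finsupp.sumElim_inr]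
    rw [Finsupp.prod, Finset.prod_eq_zero (Finsupp.mem_support_iff.2 hj₀), mul_zero]
    simp only
    rw [if_neg (by tauto), zero_pow hj₀]

lemma coeff_toBinomial (m n : ℕ) (p : MvPolynomial (Fin (m + 1) ⊕ Fin (n + 1)) ℤ)
    (u : Fin (m + 1) →₀ ℕ) (v : Fin (n + 1) →₀ ℕ) :
    coeff (Finsupp.sumElim u v) (toBinomial m n p) =
      if ∀ j, v j ≠ 0 → (j : ℕ) = 0 ∨ (j : ℕ) = n then coeff (Finsupp.sumElim u v) p else 0 := by
  classical
  induction p using MvPolynomial.induction_on' with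
  | monomial t a =>
    obtain ⟨u', v', rfl⟩ := exists_eq_sumElim t
    rw [toBinomial_monomial]
    by_cases h : v' = v
    · subst h
      split_ifs <;> simp
    · have hne : Finsupp.sumElim u' v' ≠ Finsupp.sumElim u v := fun h' => h (sumElim_inj.1 h').2
      rw [coeff_monomial, if_neg hne, ite_self]
      split_ifs
      · rw [coeff_monomial, if_neg hne]
      · rfl
  | add p q hp hq =>
    rw [map_add, coeff_add, hp, hq, coeff_add]
    split_ifs <;> simp

lemma height_toBinomial_le (m n : ℕ) (p : MvPolynomial (Fin (m + 1) ⊕ Fin (n + 1)) ℤ) :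
    height (toBinomial m n p) ≤ height p := by
  have : CoeffBound (toBinomial m n p) (height p) := fun s => by
    obtain ⟨u, v, rfl⟩ := exists_eq_sumElim s
    rw [coeff_toBinomial]
    split_ifs
    · exact coeffBound_height p _
    · simp
  exact_mod_cast this.height_le

lemma height_powerSum_le_height_toBinomial {n : ℕ} (hn : 1 ≤ n) :
    height (powerSum n) ≤ height (toBinomial 3 n (genRes 3 n)) := by
  have : CoeffBound (powerSum n) (height (toBinomial 3 n (genRes 3 n))) := fun s => by
    have h := coeffBound_height (toBinomial 3 n (genRes 3 n))
      (Finsupp.sumElim (s.mapDomain Fin.rev) (tripleExp 0 0 (Fin.last n)))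
    have hres : resCoeff n (0 : Fin (n + 1)) (0 : Fin (n + 1)) (Fin.last n) = powerSum n := by
      simp [resCoeff, orbitSum, show n ≠ 0 by lia]
    rw [coeff_toBinomial, if_pos, coeff_genRes_three n ⟨le_rfl, Fin.zero_le _⟩, hres,
      Int.cast_mul, abs_mul] at h
    · have h' : |((coeff (s.mapDomain Fin.rev) (signedRev cubicSign (powerSum n)) : ℤ) : ℝ)| =
          |((coeff s (powerSum n) : ℤ) : ℝ)| := by
        exact_mod_cast abs_coeff_signedRev abs_cubicSign (powerSum n) s
      simpa [h', abs_pow] using h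
    · intro j hj
      by_contra! hj'
      refine hj ?_
      have h₀ : 0 ≠ j := fun h => hj'.1 (by simp [← h])
      have h₁ : Fin.last n ≠ j := fun h => hj'.2 (by simp [← h])
      simp [tripleExp, h₀, h₁]
  exact_mod_cast this.height_le

lemma height_genRes_three_le {A : ℝ} {n : ℕ} (hA : 1 ≤ A * (90 / 49) ^ n)
    (H : ∀ m ≤ n, CoeffBound (powerSum m) ((90 / 49) ^ m * A)) :
    (height (genRes 3 n) : ℝ) ≤ (90 / 49) ^ n * A := by
  refine CoeffBound.height_le fun s => ?_
  obtain ⟨u, v, rfl⟩ := exists_eq_sumElim s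
  by_cases h : ∃ i j k : Fin (n + 1), (i ≤ j ∧ j ≤ k) ∧ v = tripleExp i j k
  · obtain ⟨i, j, k, hs, rfl⟩ := h
    have := (coeffBound_signedRev abs_cubicSign).2
      (coeffBound_resCoeff hA H (i := i) (j := j) (k := k) hs.2 k.is_le) u
    rw [coeff_genRes_three n hs, Int.cast_mul, abs_mul]
    simpa [abs_pow] using this
  · rw [coeff_genRes_three_eq_zero n fun i j k hs hv => h ⟨i, j, k, hs, hv⟩, Int.cast_zero,
      abs_zero, mul_comm]
    linarith

/-- For all sufficiently large `n`, the height of the resultant of a generic cubic with a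
generic degree-`n` polynomial equals the height of the resultant of a generic cubic with the
generic binomial `g₀ + gₙxⁿ`. -/
theorem height_cubic_eq_binomial :
    ∃ N : ℕ, ∀ n : ℕ, N ≤ n → height (genRes 3 n) = height (toBinomial 3 n (genRes 3 n)) := by
  obtain ⟨N, hN⟩ := exists_forall_height_powerSum_le
  refine ⟨N, fun n hn => ?_⟩
  obtain ⟨hn₁, H⟩ := hN n hn
  have hpos : (1 : ℝ) ≤ height (powerSum n) := by
    obtain ⟨m, rfl⟩ := Nat.exists_eq_add_of_le' hn₁
    exact_mod_cast height_powerSum_pos m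
  have hle := height_genRes_three_le (by rwa [div_mul_cancel₀ _ (by positivity)]) H
  rw [mul_div_cancel₀ _ (by positivity)] at hle
  refine le_antisymm ?_ (height_toBinomial_le 3 n _)
  exact (Nat.cast_le.1 hle).trans (height_powerSum_le_height_toBinomial hn₁)
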